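/- arXiv:2302.05867 — 5 statements merged into one kernel-verified Lean document; each statement's English description precedes it below -/
import Mathlib

section
/- Let c > 0 and let u : [0, ∞) → [0, ∞) satisfy u(0) = 0 and u(t) > 0 for all t ∈ (0, c], and suppose u is nondecreasing on [0, c] and superadditive on [0, c]. Set a = u(c) and define u* : [0, a) → [0, c] by u*(t) = inf { r ∈ (0, c] : t < u(r) }. Then u*(0) = 0, u* is nondecreasing on [0, a), u* is subadditive on [0, a) (i.e., u*(s + t) ≤ u*(s) + u*(t) whenever s, t, s + t ∈ [0, a)), u* is upper semicontinuous on [0, a), and u* is continuous at 0. -/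
/-- Let `c > 0` and `u : [0,∞) → [0,∞)` with `u 0 = 0`, `u > 0` on `(0, c]`,
`u` nondecreasing on `[0, c]` and superadditive on `[0, c]`.  Set `a = u c` and let
`u* : [0, a) → [0, c]` be `u* t = sInf { r ∈ (0, c] : t < u r }`.  Then `u* 0 = 0`,
`u*` is nondecreasing on `[0, a)`, subadditive on `[0, a)`, upper semicontinuous on
`[0, a)`, and continuous at `0`. -/
theorem stmt0 (c : ℝ) (hc : 0 < c) (u : ℝ → ℝ)
    (hu0 : u 0 = 0)
    (hupos : ∀ t ∈ Set.Ioc 0 c, 0 < u t)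
    (hunn : ∀ t : ℝ, 0 ≤ t → 0 ≤ u t)
    (hmono : MonotoneOn u (Set.Icc 0 c))
    (hsuper : ∀ x y : ℝ, x ∈ Set.Icc 0 c → y ∈ Set.Icc 0 c → x + y ∈ Set.Icc 0 c →
      u x + u y ≤ u (x + y))
    (a : ℝ) (ha : a = u c)
    (ustar : ℝ → ℝ)
    (hstar : ∀ t ∈ Set.Ico 0 a, ustar t = sInf {r : ℝ | r ∈ Set.Ioc 0 c ∧ t < u r}) :
    ustar 0 = 0 ∧
    MonotoneOn ustar (Set.Ico 0 a) ∧
    (∀ s t : ℝ, s ∈ Set.Ico 0 a → t ∈ Set.Ico 0 a → s + t ∈ Set.Ico 0 a →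
      ustar (s + t) ≤ ustar s + ustar t) ∧
    (∀ x ∈ Set.Ico 0 a, ∀ ε : ℝ, 0 < ε → ∃ δ : ℝ, 0 < δ ∧
      ∀ x' ∈ Set.Ico 0 a, |x' - x| < δ → ustar x' < ustar x + ε) ∧
    (∀ ε : ℝ, 0 < ε → ∃ δ : ℝ, 0 < δ ∧
      ∀ t ∈ Set.Ico 0 a, |t - 0| < δ → |ustar t - ustar 0| < ε) := by
  have ustar_le : ∀ t ∈ Set.Ico 0 a, ∀ r ∈ Set.Ioc 0 c, t < u r → ustar t ≤ r := by
    intro t ht r hr htr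
    rw [hstar t ht]
    exact csInf_le ⟨0, fun _ h => h.1.1.le⟩ ⟨hr, htr⟩
  have nonempty : ∀ t ∈ Set.Ico 0 a, {r : ℝ | r ∈ Set.Ioc 0 c ∧ t < u r}.Nonempty :=
    fun t ht => ⟨c, ⟨hc, le_rfl⟩, ha ▸ ht.2⟩
  have exists_lt : ∀ t ∈ Set.Ico 0 a, ∀ z, ustar t < z →
      ∃ r ∈ Set.Ioc 0 c, t < u r ∧ r < z := by
    intro t ht z hz
    rw [hstar t ht] at hz
    obtain ⟨r, ⟨hr, htr⟩, hrz⟩ := exists_lt_of_csInf_lt (nonempty t ht) hz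
    exact ⟨r, hr, htr, hrz⟩
  have ustar_nonneg : ∀ t ∈ Set.Ico 0 a, 0 ≤ ustar t := by
    intro t ht
    rw [hstar t ht]
    exact le_csInf (nonempty t ht) fun _ h => h.1.1.le
  have ustar_le_c : ∀ t ∈ Set.Ico 0 a, ustar t ≤ c :=
    fun t ht => ustar_le t ht c ⟨hc, le_rfl⟩ (ha ▸ ht.2)
  have zero_mem : (0 : ℝ) ∈ Set.Ico 0 a := ⟨le_rfl, ha ▸ hupos c ⟨hc, le_rfl⟩⟩
  have ustar_zero : ustar 0 = 0 := by
    refine le_antisymm (le_of_forall_pos_le_add fun ε hε => ?_) (ustar_nonneg 0 zero_mem)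
    have hmem : min ε c ∈ Set.Ioc 0 c := ⟨lt_min hε hc, min_le_right _ _⟩
    linarith [ustar_le 0 zero_mem _ hmem (hupos _ hmem), min_le_left ε c]
  have usc : ∀ x ∈ Set.Ico 0 a, ∀ ε : ℝ, 0 < ε → ∃ δ : ℝ, 0 < δ ∧
      ∀ x' ∈ Set.Ico 0 a, |x' - x| < δ → ustar x' < ustar x + ε := by
    intro x hx ε hε
    obtain ⟨r, hr, hxr, hrlt⟩ := exists_lt x hx (ustar x + ε) (by linarith)
    refine ⟨u r - x, sub_pos.2 hxr, fun x' hx' hd => ?_⟩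
    have hx'r : x' < u r := by linarith [le_abs_self (x' - x)]
    exact (ustar_le x' hx' r hr hx'r).trans_lt hrlt
  refine ⟨ustar_zero, ?_, ?_, usc, ?_⟩
  · intro s hs t ht hst
    by_contra! h
    obtain ⟨r, hr, htr, hrlt⟩ := exists_lt t ht _ h
    exact (ustar_le s hs r hr (hst.trans_lt htr)).not_gt hrlt
  · intro s t hs ht hst
    by_contra! h
    obtain ⟨r, hr, hsr, hrlt⟩ := exists_lt s hs (ustar (s + t) - ustar t) (by linarith)
    obtain ⟨q, hq, htq, hqlt⟩ := exists_lt t ht (ustar (s + t) - r) (by linarith)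
    have hle : r + q ≤ c := by linarith [ustar_le_c _ hst]
    have hpos : 0 < r + q := add_pos hr.1 hq.1
    have hsum := hsuper r q ⟨hr.1.le, hr.2⟩ ⟨hq.1.le, hq.2⟩ ⟨hpos.le, hle⟩
    linarith [ustar_le _ hst (r + q) ⟨hpos, hle⟩ (by linarith)]
  · intro ε hε
    obtain ⟨δ, hδ, h⟩ := usc 0 zero_mem ε hε
    refine ⟨δ, hδ, fun t ht hd => ?_⟩
    have hlt := h t ht hd
    rw [ustar_zero, zero_add] at hlt
    rwa [ustar_zero, sub_zero, abs_of_nonneg (ustar_nonneg t ht)]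
end

section
/- Let (X, d) be a metric space, let n ≥ 1, and for 1 ≤ j ≤ n let u_j : [0, ∞) → [0, ∞) be nondecreasing with u_j(0) = 0. Let R : X^n → [0, 1]. Then the following are equivalent: (a) for every 1 ≤ j ≤ n and all tuples x̄, ȳ ∈ X^n that differ only in their j-th coordinate, |R(x̄) − R(ȳ)| ≤ u_j(d(x_j, y_j)); (b) R is 1-Lipschitz with respect to d_R, i.e., |R(x̄) − R(ȳ)| ≤ Σ_{j=1}^{n} d_{u_j}(x_j, y_j) for all x̄, ȳ ∈ X^n. -/
/-- The chain pseudometric `d_u` associated with a metric space `(X, d)` and a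
modulus `u`. -/
noncomputable def chainDist {X : Type} [MetricSpace X] (u : ℝ → ℝ) (x y : X) : ℝ :=
  sInf {s : ℝ | ∃ (m : ℕ) (z : ℕ → X), 1 ≤ m ∧ z 0 = x ∧ z m = y ∧
    s = ∑ k ∈ Finset.range m, u (dist (z k) (z (k + 1)))}

theorem chainDist_nonneg {X : Type} [MetricSpace X] {u : ℝ → ℝ}
    (hu : ∀ t : ℝ, 0 ≤ t → 0 ≤ u t) (x y : X) : 0 ≤ chainDist u x y := by
  refine Real.sInf_nonneg ?_
  rintro s ⟨m, z, -, -, -, rfl⟩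
  exact Finset.sum_nonneg fun k _ => hu _ dist_nonneg

theorem chainDist_le {X : Type} [MetricSpace X] {u : ℝ → ℝ}
    (hu : ∀ t : ℝ, 0 ≤ t → 0 ≤ u t) (x y : X) : chainDist u x y ≤ u (dist x y) := by
  refine csInf_le ⟨0, ?_⟩ ⟨1, fun k => if k = 0 then x else y, le_rfl, by simp, by simp, by simp⟩
  rintro s ⟨m, z, -, -, -, rfl⟩
  exact Finset.sum_nonneg fun k _ => hu _ dist_nonneg

theorem chainDist_self {X : Type} [MetricSpace X] {u : ℝ → ℝ} (hu0 : u 0 = 0)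
    (hu : ∀ t : ℝ, 0 ≤ t → 0 ≤ u t) (x : X) : chainDist u x x = 0 :=
  le_antisymm (by simpa [hu0] using chainDist_le hu x x) (chainDist_nonneg hu x x)

/-- A function with modulus `u` is `1`-Lipschitz for the chain pseudometric `d_u`. -/
theorem abs_sub_le_chainDist {X : Type} [MetricSpace X] {u : ℝ → ℝ} {f : X → ℝ}
    (hf : ∀ x y, |f x - f y| ≤ u (dist x y)) (x y : X) :
    |f x - f y| ≤ chainDist u x y := by
  refine le_csInf ⟨_, 1, fun k => if k = 0 then x else y, le_rfl, by simp, by simp, rfl⟩ ?_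
  rintro s ⟨m, z, -, rfl, rfl, rfl⟩
  rw [← Real.dist_eq]
  refine (dist_le_range_sum_dist (fun k => f (z k)) m).trans (Finset.sum_le_sum fun k _ => ?_)
  simpa only [Real.dist_eq] using hf (z k) (z (k + 1))

/-- Coordinatewise bounds add up when the coordinates are changed one at a time. -/
theorem abs_sub_piecewise_le_sum {ι X : Type} [DecidableEq ι] {R : (ι → X) → ℝ}
    {D : ι → X → X → ℝ}
    (h : ∀ (j : ι) (x : ι → X) (a : X), |R x - R (Function.update x j a)| ≤ D j (x j) a)
    (x y : ι → X) (s : Finset ι) :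
    |R x - R (s.piecewise y x)| ≤ ∑ j ∈ s, D j (x j) (y j) := by
  induction s using Finset.induction_on with
  | empty => simp
  | insert j s hj ih =>
    rw [Finset.sum_insert hj, Finset.piecewise_insert]
    have hstep := h j (s.piecewise y x) (y j)
    rw [Finset.piecewise_eq_of_notMem _ _ _ hj] at hstep
    have htri := abs_sub_le (R x) (R (s.piecewise y x))
      (R (Function.update (s.piecewise y x) j (y j)))
    linarith

/-- Let `(X, d)` be a metric space, `n ≥ 1`, and for each `j` let
`u j : [0,∞) → [0,∞)` be nondecreasing with `u j 0 = 0`.  Let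
`R : X^n → [0,1]`.  Then `R` satisfies the coordinatewise uniform continuity
condition with respect to the moduli `u j` iff `R` is `1`-Lipschitz with respect
to `d_R(x̄, ȳ) = Σ_j d_{u j}(x̄ j, ȳ j)`. -/
theorem stmt3 {X : Type} [MetricSpace X] (n : ℕ) (hn : 1 ≤ n)
    (u : Fin n → ℝ → ℝ)
    (hu0 : ∀ j, u j 0 = 0)
    (hunn : ∀ j, ∀ t : ℝ, 0 ≤ t → 0 ≤ u j t)
    (hmono : ∀ j, MonotoneOn (u j) (Set.Ici 0))
    (R : (Fin n → X) → ℝ) (hR : ∀ x, R x ∈ Set.Icc (0 : ℝ) 1) :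
    (∀ (j : Fin n) (x y : Fin n → X), (∀ k, k ≠ j → x k = y k) →
      |R x - R y| ≤ u j (dist (x j) (y j))) ↔
    (∀ x y : Fin n → X, |R x - R y| ≤ ∑ j, chainDist (u j) (x j) (y j)) := by
  constructor
  · intro h x y
    have hcoord : ∀ (j : Fin n) (x : Fin n → X) (a : X),
        |R x - R (Function.update x j a)| ≤ chainDist (u j) (x j) a := by
      intro j x a
      have hf : ∀ b c : X, |R (Function.update x j b) - R (Function.update x j c)| ≤
          u j (dist b c) := fun b c => by
        simpa using h j (Function.update x j b) (Function.update x j c)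
          fun k hk => by simp [hk]
      simpa using abs_sub_le_chainDist (f := fun b => R (Function.update x j b)) hf (x j) a
    simpa using abs_sub_piecewise_le_sum (D := fun j => chainDist (u j)) hcoord x y Finset.univ
  · intro h j x y hxy
    refine (h x y).trans ?_
    rw [Finset.sum_eq_single j]
    · exact chainDist_le (hunn j) _ _
    · intro k _ hk
      rw [hxy k hk, chainDist_self (hu0 k) (hunn k)]
    · simp
end

section
/- Let L be a continuous signature with finitely many relation symbols whose moduli are all nondecreasing. Let (X, d) be a metric space and, for each relation symbol i of arity n_i, let S_i ⊆ X^{n_i} and let R_i : S_i → [0, 1] be 1-Lipschitz with respect to d_{R_i} (the sum over coordinates of the chain pseudometrics d_{u_{i,j}}). Then there exist functions R̄_i : X^{n_i} → [0, 1] with R̄_i restricted to S_i equal to R_i such that (X, d, (R̄_i)_{i ∈ I}) is a continuous L-pre-structure; in fact R̄_i(x̄) = max { 0, sup { R_i(ȳ) − d_{R_i}(x̄, ȳ) : ȳ ∈ S_i } } has these properties. -/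
namespace ContLogic

/-- A continuous signature with finitely many relation symbols, all of whose
moduli of continuity are nondecreasing. -/
structure Sig : Type 1 where
  I : Type
  finI : Finite I
  n : I → ℕ
  n_pos : ∀ i, 1 ≤ n i
  u : (i : I) → Fin (n i) → ℝ → ℝ
  u_zero : ∀ i j, u i j 0 = 0
  u_nonneg : ∀ i j t, 0 ≤ u i j t
  u_pos : ∀ i j t, 0 < t → 0 < u i j t
  u_lim : ∀ i j, Filter.Tendsto (u i j) (nhdsWithin 0 (Set.Ioi 0)) (nhds 0)
  u_mono : ∀ i j, MonotoneOn (u i j) (Set.Ici 0)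

/-- The chain pseudometric `d_u` associated with a metric space `(X, d)` and a
modulus `u`. -/
noncomputable def chainDist {X : Type} [MetricSpace X] (u : ℝ → ℝ) (x y : X) : ℝ :=
  sInf {s : ℝ | ∃ (m : ℕ) (z : ℕ → X), 1 ≤ m ∧ z 0 = x ∧ z m = y ∧
    s = ∑ k ∈ Finset.range m, u (dist (z k) (z (k + 1)))}

section ChainDist

variable {X : Type} [MetricSpace X] {u : ℝ → ℝ}

lemma chainDist_set_bddBelow (hu : ∀ t, 0 ≤ u t) (x y : X) :
    BddBelow {s : ℝ | ∃ (m : ℕ) (z : ℕ → X), 1 ≤ m ∧ z 0 = x ∧ z m = y ∧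
      s = ∑ k ∈ Finset.range m, u (dist (z k) (z (k + 1)))} := by
  refine ⟨0, ?_⟩
  rintro _ ⟨m, z, -, -, -, rfl⟩
  exact Finset.sum_nonneg fun k _ => hu _

lemma chainDist_set_nonempty (x y : X) :
    {s : ℝ | ∃ (m : ℕ) (z : ℕ → X), 1 ≤ m ∧ z 0 = x ∧ z m = y ∧
      s = ∑ k ∈ Finset.range m, u (dist (z k) (z (k + 1)))}.Nonempty :=
  ⟨_, 1, fun k => if k = 0 then x else y, le_rfl, by simp, by simp, rfl⟩

lemma chainDist_nonneg (hu : ∀ t, 0 ≤ u t) (x y : X) : 0 ≤ chainDist u x y := by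
  refine Real.sInf_nonneg ?_
  rintro _ ⟨m, z, -, -, -, rfl⟩
  exact Finset.sum_nonneg fun k _ => hu _

lemma chainDist_self (hu : ∀ t, 0 ≤ u t) (hu0 : u 0 = 0) (x : X) : chainDist u x x = 0 :=
  le_antisymm
    (csInf_le (chainDist_set_bddBelow hu x x)
      ⟨1, fun _ => x, le_rfl, rfl, rfl, by simp [hu0]⟩)
    (chainDist_nonneg hu x x)

/-- Prepending a point to a chain costs at most one step. -/
lemma chainDist_le_add_chainDist (hu : ∀ t, 0 ≤ u t) (x y w : X) :
    chainDist u x w ≤ u (dist x y) + chainDist u y w := by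
  rw [← sub_le_iff_le_add']
  refine le_csInf (chainDist_set_nonempty y w) ?_
  rintro _ ⟨m, z, -, rfl, rfl, rfl⟩
  rw [sub_le_iff_le_add']
  refine csInf_le (chainDist_set_bddBelow hu _ _)
    ⟨m + 1, fun k => Nat.casesOn k x z, by omega, rfl, rfl, ?_⟩
  rw [Finset.sum_range_succ', add_comm]
  rfl

end ChainDist

lemma sum_chainDist_le_add {X : Type} [MetricSpace X] {n : ℕ} {u : Fin n → ℝ → ℝ}
    (hu : ∀ j t, 0 ≤ u j t) {j : Fin n} {x y : Fin n → X}
    (hxy : ∀ k, k ≠ j → x k = y k) (w : Fin n → X) :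
    ∑ k, chainDist (u k) (x k) (w k) ≤
      u j (dist (x j) (y j)) + ∑ k, chainDist (u k) (y k) (w k) := by
  rw [← Finset.add_sum_erase _ _ (Finset.mem_univ j),
    ← Finset.add_sum_erase _ (fun k => chainDist (u k) (y k) (w k)) (Finset.mem_univ j),
    ← add_assoc]
  refine add_le_add (chainDist_le_add_chainDist (hu j) _ _ _) (le_of_eq ?_)
  exact Finset.sum_congr rfl fun k hk => by rw [hxy k (Finset.ne_of_mem_erase hk)]

/-- The truncated supremum of `f - D` grows by at most `c` if `D` decreases by at most `c`. -/
lemma max_zero_sSup_sub_le_add {α : Type*} {S : Set α} {f D D' : α → ℝ} {c : ℝ} (hc : 0 ≤ c)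
    (hbdd : ∀ y ∈ S, f y - D' y ≤ 1) (hD : ∀ y ∈ S, D' y ≤ c + D y) :
    max 0 (sSup {t : ℝ | ∃ y ∈ S, t = f y - D y}) ≤
      c + max 0 (sSup {t : ℝ | ∃ y ∈ S, t = f y - D' y}) := by
  have hnn : 0 ≤ c + max 0 (sSup {t : ℝ | ∃ y ∈ S, t = f y - D' y}) :=
    add_nonneg hc (le_max_left _ _)
  refine max_le hnn (Real.sSup_le ?_ hnn)
  rintro _ ⟨y, hy, rfl⟩
  have hb : BddAbove {t : ℝ | ∃ y ∈ S, t = f y - D' y} :=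
    ⟨1, by rintro _ ⟨y, hy, rfl⟩; exact hbdd y hy⟩
  have h := (le_csSup hb ⟨y, hy, rfl⟩).trans (le_max_right 0 _)
  linarith [hD y hy]

/-- Any partially defined continuous `L`-pre-structure has a conservative
extension: given partially defined relations `R i` on `S i ⊆ X^{n_i}` which are
`1`-Lipschitz for `d_{R_i}`, there are totally defined relations `R̄ i`
extending them and making `(X, d, (R̄ i))` a continuous `L`-pre-structure;
in fact `R̄ i x̄ = max 0 (sup { R i ȳ − d_{R_i}(x̄, ȳ) : ȳ ∈ S i })` works. -/
theorem stmt4 (L : Sig) {X : Type} [MetricSpace X]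
    (S : (i : L.I) → Set (Fin (L.n i) → X))
    (R : (i : L.I) → (Fin (L.n i) → X) → ℝ)
    (hmem : ∀ i, ∀ x ∈ S i, R i x ∈ Set.Icc (0 : ℝ) 1)
    (hlip : ∀ i, ∀ x ∈ S i, ∀ y ∈ S i,
      |R i x - R i y| ≤ ∑ j, chainDist (L.u i j) (x j) (y j)) :
    ∃ Rb : (i : L.I) → (Fin (L.n i) → X) → ℝ,
      (∀ i x, Rb i x =
        max 0 (sSup {t : ℝ | ∃ y ∈ S i,
          t = R i y - ∑ j, chainDist (L.u i j) (x j) (y j)})) ∧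
      (∀ i x, Rb i x ∈ Set.Icc (0 : ℝ) 1) ∧
      (∀ i, ∀ x ∈ S i, Rb i x = R i x) ∧
      (∀ (i : L.I) (j : Fin (L.n i)) (x y : Fin (L.n i) → X),
        (∀ k, k ≠ j → x k = y k) →
        |Rb i x - Rb i y| ≤ L.u i j (dist (x j) (y j))) := by
  have hD (i : L.I) (x y : Fin (L.n i) → X) :
      0 ≤ ∑ j, chainDist (L.u i j) (x j) (y j) :=
    Finset.sum_nonneg fun j _ => chainDist_nonneg (L.u_nonneg i j) _ _
  have hle (i : L.I) (x : Fin (L.n i) → X) :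
      ∀ y ∈ S i, R i y - ∑ j, chainDist (L.u i j) (x j) (y j) ≤ 1 := fun y hy => by
    linarith [hD i x y, (hmem i y hy).2]
  have step (i : L.I) (j : Fin (L.n i)) (x y : Fin (L.n i) → X)
      (hxy : ∀ k, k ≠ j → x k = y k) :=
    max_zero_sSup_sub_le_add (f := R i) (L.u_nonneg i j (dist (y j) (x j))) (hle i y)
      fun w _ => sum_chainDist_le_add (L.u_nonneg i) (fun k hk => (hxy k hk).symm) w
  refine ⟨_, fun i x => rfl, fun i x => ⟨le_max_left _ _, ?_⟩, fun i x hx => ?_,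
    fun i j x y hxy => ?_⟩
  · refine max_le zero_le_one (Real.sSup_le ?_ zero_le_one)
    rintro _ ⟨y, hy, rfl⟩
    exact hle i x y hy
  · have hgreatest : IsGreatest {t : ℝ | ∃ y ∈ S i,
        t = R i y - ∑ j, chainDist (L.u i j) (x j) (y j)} (R i x) := by
      refine ⟨⟨x, hx, ?_⟩, ?_⟩
      · simp [chainDist_self (L.u_nonneg i _) (L.u_zero i _)]
      · rintro _ ⟨y, hy, rfl⟩
        linarith [(abs_le.1 (hlip i x hx y hy)).1]
    rw [hgreatest.csSup_eq, max_eq_right (hmem i x hx).1]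
  · have h₁ := step i j x y hxy
    have h₂ := step i j y x fun k hk => (hxy k hk).symm
    rw [dist_comm] at h₁
    exact abs_sub_le_iff.2 ⟨by linarith, by linarith⟩

end ContLogic
end

section
/- Let L be a proper continuous signature, let Δ = ℚ ∩ (0, ∞), and let V ⊆ [0,1] with ℚ ∩ [0,1] ⊆ V be such that (Δ, V) is a good value pair for L. Let M be a countable (Δ,V)-valued continuous L-pre-structure with the rational Urysohn property. Then any continuous L-structure M̄ that contains M as a substructure with M dense in M̄ has the Urysohn property. -/
namespace ContLogic

/-- A continuous `L`-pre-structure: a metric space together with `[0,1]`-valued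
relations respecting the moduli of continuity. -/
structure PreStr (L : Sig) : Type 1 where
  M : Type
  d : M → M → ℝ
  d_self : ∀ x, d x x = 0
  d_eq_zero : ∀ x y, d x y = 0 → x = y
  d_comm : ∀ x y, d x y = d y x
  d_triangle : ∀ x y z, d x z ≤ d x y + d y z
  R : (i : L.I) → (Fin (L.n i) → M) → ℝ
  R_mem : ∀ i x, R i x ∈ Set.Icc (0 : ℝ) 1
  R_uc : ∀ (i : L.I) (j : Fin (L.n i)) (x y : Fin (L.n i) → M),
    (∀ k, k ≠ j → x k = y k) → |R i x - R i y| ≤ L.u i j (d (x j) (y j))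

/-- The metric of `A` is complete (every Cauchy sequence converges). -/
def PreStr.IsComplete {L : Sig} (A : PreStr L) : Prop :=
  ∀ f : ℕ → A.M,
    (∀ ε : ℝ, 0 < ε → ∃ N : ℕ, ∀ m ≥ N, ∀ n ≥ N, A.d (f m) (f n) < ε) →
    ∃ x : A.M, ∀ ε : ℝ, 0 < ε → ∃ N : ℕ, ∀ n ≥ N, A.d (f n) x < ε

/-- The metric of `A` is separable (there is a countable dense subset). -/
def PreStr.Separable {L : Sig} (A : PreStr L) : Prop :=
  ∃ D : Set A.M, D.Countable ∧ ∀ x : A.M, ∀ ε : ℝ, 0 < ε → ∃ y ∈ D, A.d x y < ε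

/-- `f` is an isomorphic embedding of continuous `L`-pre-structures. -/
def Emb {L : Sig} (A B : PreStr L) (f : A.M → B.M) : Prop :=
  Function.Injective f ∧
  (∀ x y : A.M, B.d (f x) (f y) = A.d x y) ∧
  (∀ (i : L.I) (x : Fin (L.n i) → A.M), B.R i (f ∘ x) = A.R i x)

/-- The amalgamation property for a class `K` of continuous `L`-pre-structures. -/
def HasAP {L : Sig} (K : PreStr L → Prop) : Prop :=
  ∀ (A P Q : PreStr L), K A → K P → K Q →
    ∀ (φ : A.M → P.M) (ψ : A.M → Q.M), Emb A P φ → Emb A Q ψ →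
      ∃ (N : PreStr L) (ι : P.M → N.M) (τ : Q.M → N.M),
        K N ∧ Emb P N ι ∧ Emb Q N τ ∧ ι ∘ φ = τ ∘ ψ

/-- The strong amalgamation property for a class `K`. -/
def HasSAP {L : Sig} (K : PreStr L → Prop) : Prop :=
  ∀ (A P Q : PreStr L), K A → K P → K Q →
    ∀ (φ : A.M → P.M) (ψ : A.M → Q.M), Emb A P φ → Emb A Q ψ →
      ∃ (N : PreStr L) (ι : P.M → N.M) (τ : Q.M → N.M),
        K N ∧ Emb P N ι ∧ Emb Q N τ ∧ ι ∘ φ = τ ∘ ψ ∧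
        Set.range ι ∩ Set.range τ = Set.range (ι ∘ φ) ∧
        Set.range ι ∩ Set.range τ = Set.range (τ ∘ ψ)

/-- The joint embedding property for a class `K`. -/
def HasJEP {L : Sig} (K : PreStr L → Prop) : Prop :=
  ∀ A B : PreStr L, K A → K B →
    ∃ (C : PreStr L) (f : A.M → C.M) (g : B.M → C.M), K C ∧ Emb A C f ∧ Emb B C g

/-- `I_{i,j} = { r ≥ 0 : u_{i,j}(r) < 1 }`. -/
def Sig.Ival (L : Sig) (i : L.I) (j : Fin (L.n i)) : Set ℝ :=
  {r : ℝ | 0 ≤ r ∧ L.u i j r < 1}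

/-- `L` is semiproper. -/
def Sig.Semiproper (L : Sig) : Prop :=
  (∀ i j, BddAbove (L.Ival i j)) ∧
  (∀ i j, ∀ r s : ℝ, r ∈ L.Ival i j → s ∈ L.Ival i j → r + s ∈ L.Ival i j →
    L.u i j r + L.u i j s ≤ L.u i j (r + s)) ∧
  (∀ i : L.I, 2 ≤ L.n i → ∀ j, ∃ K : ℝ, 0 < K ∧ ∀ r ∈ L.Ival i j, L.u i j r = K * r)

/-- `u` is upper semicontinuous on `J`. -/
def USCOn (u : ℝ → ℝ) (J : Set ℝ) : Prop :=
  ∀ x ∈ J, ∀ ε : ℝ, 0 < ε → ∃ δ : ℝ, 0 < δ ∧ ∀ x' ∈ J, |x' - x| < δ → u x' < u x + ε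

/-- `L` is proper. -/
def Sig.Proper (L : Sig) : Prop :=
  L.Semiproper ∧ ∀ i j, USCOn (L.u i j) (L.Ival i j)

/-- `L` is strongly semiproper. -/
def Sig.StronglySemiproper (L : Sig) : Prop :=
  L.Semiproper ∧
  ∀ i : L.I, L.n i = 1 → ∀ j : Fin (L.n i), ∀ r₁ r₂ : ℝ, 0 < r₁ → 0 < r₂ →
    r₁ + r₂ ∈ L.Ival i j →
    sInf (L.u i j '' Set.Ioi r₁) + sInf (L.u i j '' Set.Ioi r₂) ≤ L.u i j (r₁ + r₂)

/-- `L` is Lipschitz. -/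
def Sig.Lipschitz (L : Sig) : Prop :=
  ∀ i j, BddAbove (L.Ival i j) ∧ ∃ K : ℝ, 0 < K ∧ ∀ r ∈ L.Ival i j, L.u i j r = K * r

/-- `B` is a one-point extension of `A` along the embedding `e`. -/
def OnePointExt {L : Sig} (A B : PreStr L) (e : A.M → B.M) : Prop :=
  Emb A B e ∧ ∃ x : B.M, x ∉ Set.range e ∧ ∀ y : B.M, y ∈ Set.range e ∨ y = x

/-- `U` has the Urysohn property. -/
def HasUrysohn {L : Sig} (U : PreStr L) : Prop :=
  ∀ (A B : PreStr L) (e : A.M → B.M), Finite A.M → OnePointExt A B e →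
    ∀ φ : A.M → U.M, Emb A U φ →
      ∃ ψ : B.M → U.M, Emb B U ψ ∧ ψ ∘ e = φ

/-- `Δ` is a distance value set. -/
def DistValueSet (Δ : Set ℝ) : Prop :=
  Δ ⊆ Set.Ioi 0 ∧
  ∀ a ∈ Δ, ∀ b ∈ Δ,
    (BddAbove Δ → min (a + b) (sSup Δ) ∈ Δ) ∧ (¬ BddAbove Δ → a + b ∈ Δ)

/-- `(Δ, V)` is a good value pair for `L`. -/
def GoodPair (L : Sig) (Δ V : Set ℝ) : Prop :=
  DistValueSet Δ ∧ V ⊆ Set.Icc 0 1 ∧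
  (BddAbove Δ → ∀ i j, 1 ≤ L.u i j (sSup Δ)) ∧
  (0 : ℝ) ∈ V ∧
  ∀ v ∈ V, ∀ δ ∈ Δ, ∀ i j, L.u i j δ < v → v - L.u i j δ ∈ V

/-- `A` is `(Δ, V)`-valued. -/
def Valued {L : Sig} (Δ V : Set ℝ) (A : PreStr L) : Prop :=
  (∀ x y : A.M, x ≠ y → A.d x y ∈ Δ) ∧ ∀ i x, A.R i x ∈ V

/-- `U` has the `(Δ, V)`-Urysohn property. -/
def HasUrysohnRel {L : Sig} (Δ V : Set ℝ) (U : PreStr L) : Prop :=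
  ∀ (A B : PreStr L) (e : A.M → B.M), Finite A.M →
    Valued Δ V A → Valued Δ V B → OnePointExt A B e →
    ∀ φ : A.M → U.M, Emb A U φ →
      ∃ ψ : B.M → U.M, Emb B U ψ ∧ ψ ∘ e = φ

/-- `f` is an automorphism of `A`. -/
def Aut {L : Sig} (A : PreStr L) (f : A.M → A.M) : Prop :=
  Function.Bijective f ∧ Emb A A f

/-- `f` restricted to `S` is a partial isomorphism of `A`. -/
def PartIso {L : Sig} (A : PreStr L) (S : Set A.M) (f : A.M → A.M) : Prop :=
  Set.InjOn f S ∧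
  (∀ x ∈ S, ∀ y ∈ S, A.d (f x) (f y) = A.d x y) ∧
  ∀ (i : L.I) (x : Fin (L.n i) → A.M), (∀ k, x k ∈ S) → A.R i (f ∘ x) = A.R i x

/-- `act` is an action of the group `Γ` on `A` by automorphisms. -/
def IsActionByAut (L : Sig) (Γ : Type) (gΓ : Group Γ) (A : PreStr L)
    (act : Γ → A.M → A.M) : Prop :=
  letI := gΓ
  (∀ x, act 1 x = x) ∧ (∀ g h x, act (g * h) x = act g (act h x)) ∧
  ∀ g : Γ, Aut A (act g)

/-- `(e, f)` is an embedding from the action `actA : Λ ↷ A` to `actB : Γ ↷ B`. -/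
def ActEmb (L : Sig) (Λ Γ : Type) (gΛ : Group Λ) (gΓ : Group Γ)
    (A B : PreStr L) (actA : Λ → A.M → A.M) (actB : Γ → B.M → B.M)
    (e : Λ → Γ) (f : A.M → B.M) : Prop :=
  letI := gΛ
  letI := gΓ
  Function.Injective e ∧ (∀ g h : Λ, e (g * h) = e g * e h) ∧
  Emb A B f ∧ ∀ (g : Λ) (x : A.M), actB (e g) (f x) = f (actA g x)

lemma PreStr.d_nonneg {L : Sig} (A : PreStr L) (x y : A.M) : 0 ≤ A.d x y := by
  have h := A.d_triangle x y x
  rw [A.d_self, A.d_comm y x] at h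
  linarith

lemma emb_of_dist {L : Sig} {A B : PreStr L} {f : A.M → B.M}
    (hd : ∀ x y, B.d (f x) (f y) = A.d x y)
    (hR : ∀ (i : L.I) (x : Fin (L.n i) → A.M), B.R i (f ∘ x) = A.R i x) : Emb A B f :=
  ⟨fun x y h => A.d_eq_zero x y (by rw [← hd, h, B.d_self]), hd, hR⟩

/-- A function of several variables is controlled by its variation in each variable. -/
lemma abs_sub_le_sum_of_coord {n : ℕ} {X : Type*} (h : (Fin n → X) → ℝ)
    (c : Fin n → X → X → ℝ)
    (hc : ∀ j x y, (∀ k, k ≠ j → x k = y k) → |h x - h y| ≤ c j (x j) (y j))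
    (x y : Fin n → X) : |h x - h y| ≤ ∑ j, c j (x j) (y j) := by
  classical
  suffices H : ∀ (s : Finset (Fin n)) (x : Fin n → X), (∀ k, k ∉ s → x k = y k) →
      |h x - h y| ≤ ∑ j ∈ s, c j (x j) (y j) from H Finset.univ x (by simp)
  intro s
  induction s using Finset.induction_on with
  | empty =>
    intro x hx
    have : x = y := funext fun k => hx k (by simp)
    simp [this]
  | insert j s hj ih =>
    intro x hx
    rw [Finset.sum_insert hj]
    have h1 := hc j x (Function.update x j (y j))
      (fun k hk => by rw [Function.update_of_ne hk])
    have h2 := ih (Function.update x j (y j)) (fun k hk => by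
      by_cases hkj : k = j
      · subst hkj; simp
      · rw [Function.update_of_ne hkj]
        exact hx k (by simp [hk, hkj]))
    have h3 : ∑ k ∈ s, c k (Function.update x j (y j) k) (y k) = ∑ k ∈ s, c k (x k) (y k) := by
      refine Finset.sum_congr rfl fun k hk => ?_
      rw [Function.update_of_ne (by rintro rfl; exact hj hk)]
    rw [h3] at h2
    rw [Function.update_self] at h1
    have := abs_sub_le (h x) (h (Function.update x j (y j))) (h y)
    linarith

lemma PreStr.abs_R_sub_le {L : Sig} (A : PreStr L) (i : L.I) (x y : Fin (L.n i) → A.M) :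
    |A.R i x - A.R i y| ≤ ∑ j, L.u i j (A.d (x j) (y j)) :=
  abs_sub_le_sum_of_coord (A.R i) (fun j a b => L.u i j (A.d a b)) (A.R_uc i) x y

lemma abs_sub_le_one {a b : ℝ} (ha : a ∈ Set.Icc (0 : ℝ) 1) (hb : b ∈ Set.Icc (0 : ℝ) 1) :
    |a - b| ≤ 1 := by
  obtain ⟨h1, h2⟩ := ha
  obtain ⟨h3, h4⟩ := hb
  rw [abs_le]; constructor <;> linarith

/-- `c` gives the slopes of the moduli of the relation `i`, truncated at `1`. -/
def LinearModulus (L : Sig) (i : L.I) (c : Fin (L.n i) → ℝ) : Prop :=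
  ∀ j, 0 < c j ∧ (∀ r, 0 ≤ r → L.u i j r < 1 → L.u i j r = c j * r) ∧
    ∀ r, 0 ≤ r → 1 ≤ L.u i j r → 1 ≤ c j * r

lemma LinearModulus.le_mul {L : Sig} {i : L.I} {c : Fin (L.n i) → ℝ} (h : LinearModulus L i c)
    (j : Fin (L.n i)) {r t : ℝ} (hr : 0 ≤ r) (ht : t ≤ 1) (htu : t ≤ L.u i j r) :
    t ≤ c j * r := by
  rcases lt_or_ge (L.u i j r) 1 with hu | hu
  · rw [← (h j).2.1 r hr hu]; exact htu
  · exact ht.trans ((h j).2.2 r hr hu)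

lemma LinearModulus.le_u {L : Sig} {i : L.I} {c : Fin (L.n i) → ℝ} (h : LinearModulus L i c)
    (j : Fin (L.n i)) {r t : ℝ} (hr : 0 ≤ r) (ht : t ≤ 1) (htu : t ≤ c j * r) :
    t ≤ L.u i j r := by
  rcases lt_or_ge (L.u i j r) 1 with hu | hu
  · rw [(h j).2.1 r hr hu]; exact htu
  · exact ht.trans hu

lemma LinearModulus.abs_R_sub_le {L : Sig} {i : L.I} {c : Fin (L.n i) → ℝ}
    (h : LinearModulus L i c) (A : PreStr L) (x y : Fin (L.n i) → A.M) :
    |A.R i x - A.R i y| ≤ ∑ j, c j * A.d (x j) (y j) :=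
  abs_sub_le_sum_of_coord (A.R i) (fun j a b => c j * A.d a b)
    (fun j x y hxy => h.le_mul j (A.d_nonneg _ _)
      (abs_sub_le_one (A.R_mem i x) (A.R_mem i y)) (A.R_uc i j x y hxy)) x y

/-- A McShane-type extension whose values are obtained from the prescribed ones by
subtracting weighted distances. -/
lemma exists_mcshane {X S : Type*} [Finite S] [Nonempty S] {n : ℕ} (c : Fin n → ℝ)
    (hc : ∀ j, 0 < c j) (D : X → X → ℝ) (D_self : ∀ x, D x x = 0)
    (D_nonneg : ∀ x y, 0 ≤ D x y) (D_comm : ∀ x y, D x y = D y x)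
    (D_tri : ∀ x y z, D x z ≤ D x y + D y z) (V : Set ℝ) (hV0 : (0 : ℝ) ∈ V)
    (hV : ∀ v ∈ V, ∀ j x y, 0 < v - c j * D x y → v - c j * D x y ∈ V)
    (e : S → Fin n → X) (G : S → ℝ) (hG : ∀ s, G s ∈ V) :
    ∃ R : (Fin n → X) → ℝ, (∀ t, R t ∈ V) ∧
      (∀ s t, |R s - R t| ≤ ∑ j, c j * D (s j) (t j)) ∧ (∀ s, G s ≤ R (e s)) ∧
      ∀ t b, 0 ≤ b → (∀ s, G s - ∑ j, c j * D (e s j) (t j) ≤ b) → R t ≤ b := by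
  have hmax : ∀ t : Fin n → X, ∃ s₀, ∀ s,
      G s - ∑ j, c j * D (e s j) (t j) ≤ G s₀ - ∑ j, c j * D (e s₀ j) (t j) :=
    fun t => Finite.exists_max _
  choose m hm using hmax
  have hVs : ∀ v ∈ V, ∀ (x y : Fin n → X) (s : Finset (Fin n)),
      0 < v - ∑ j ∈ s, c j * D (x j) (y j) → v - ∑ j ∈ s, c j * D (x j) (y j) ∈ V := by
    classical
    intro v hv x y s
    induction s using Finset.induction_on with
    | empty => intro _; simpa using hv
    | insert j s hj ih =>
      rw [Finset.sum_insert hj]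
      intro h
      have h0 : 0 ≤ c j * D (x j) (y j) := mul_nonneg (hc j).le (D_nonneg _ _)
      have := hV _ (ih (by linarith)) j (x j) (y j) (by linarith)
      convert this using 1
      ring
  have hlip : ∀ s t : Fin n → X,
      max 0 (G (m s) - ∑ j, c j * D (e (m s) j) (s j)) -
        max 0 (G (m t) - ∑ j, c j * D (e (m t) j) (t j)) ≤ ∑ j, c j * D (s j) (t j) := by
    intro s t
    have h1 := hm t (m s)
    have h2 : ∑ j, c j * D (e (m s) j) (t j) ≤
        ∑ j, c j * D (e (m s) j) (s j) + ∑ j, c j * D (s j) (t j) := by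
      rw [← Finset.sum_add_distrib]
      refine Finset.sum_le_sum fun j _ => ?_
      rw [← mul_add]
      exact mul_le_mul_of_nonneg_left (D_tri _ _ _) (hc j).le
    have h3 : 0 ≤ ∑ j, c j * D (s j) (t j) :=
      Finset.sum_nonneg fun j _ => mul_nonneg (hc j).le (D_nonneg _ _)
    rw [sub_le_iff_le_add]
    refine max_le ?_ ?_
    · have := le_max_left 0 (G (m t) - ∑ j, c j * D (e (m t) j) (t j))
      linarith
    · have := le_max_right 0 (G (m t) - ∑ j, c j * D (e (m t) j) (t j))
      linarith
  refine ⟨fun t => max 0 (G (m t) - ∑ j, c j * D (e (m t) j) (t j)), ?_, ?_, ?_, ?_⟩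
  · intro t
    rcases le_or_gt (G (m t) - ∑ j, c j * D (e (m t) j) (t j)) 0 with h | h
    · simpa [max_eq_left h] using hV0
    · simpa only [max_eq_right h.le] using hVs _ (hG _) _ _ _ h
  · intro s t
    rw [abs_le]
    have h1 := hlip s t
    have h2 := hlip t s
    simp only [D_comm (t _)] at h2
    constructor <;> linarith
  · intro s
    refine le_max_of_le_right ((le_of_eq ?_).trans (hm (e s) s))
    simp [D_self]
  · intro t b hb h
    exact max_le hb (h _)

/-- Approximate amalgamation of a Lipschitz relation over `F` with one over `K ∪ {none}`. -/
lemma exists_lipschitz_amalgam {F K : Type*} [Finite F] [Finite K] {n : ℕ} (c : Fin n → ℝ)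
    (hc : ∀ j, 0 < c j) (D : Option F → Option F → ℝ) (D_self : ∀ x, D x x = 0)
    (D_nonneg : ∀ x y, 0 ≤ D x y) (D_comm : ∀ x y, D x y = D y x)
    (D_tri : ∀ x y z, D x z ≤ D x y + D y z) (V : Set ℝ) (hV0 : (0 : ℝ) ∈ V)
    (hV1 : V ⊆ Set.Icc 0 1)
    (hVq : ∀ q : ℚ, 0 ≤ (q : ℝ) → (q : ℝ) ≤ 1 → (q : ℝ) ∈ V)
    (hV : ∀ v ∈ V, ∀ j x y, 0 < v - c j * D x y → v - c j * D x y ∈ V)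
    (RF : (Fin n → F) → ℝ) (hRF : ∀ t, RF t ∈ V)
    (hRFlip : ∀ s t, |RF s - RF t| ≤ ∑ j, c j * D (some (s j)) (some (t j)))
    (a : K → F) (RN : (Fin n → Option K) → ℝ) (hRN : ∀ w, RN w ∈ Set.Icc (0 : ℝ) 1)
    (κ : ℝ) (hκ : 0 < κ)
    (h1 : ∀ w t, |RN w - RF t| ≤ ∑ j, c j * D ((w j).map a) (some (t j)) + κ)
    (h2 : ∀ w w', |RN w - RN w'| ≤ ∑ j, c j * D ((w j).map a) ((w' j).map a) + κ) :
    ∃ R : (Fin n → Option F) → ℝ, (∀ t, R t ∈ V) ∧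
      (∀ s t, |R s - R t| ≤ ∑ j, c j * D (s j) (t j)) ∧
      (∀ t : Fin n → F, R (fun j => some (t j)) = RF t) ∧
      ∀ w, |R (fun j => (w j).map a) - RN w| ≤ 2 * κ := by
  have hG : ∀ w, ∃ v ∈ V, RN w - 2 * κ ≤ v ∧ (v ≤ RN w - κ ∨ v = 0) := by
    intro w
    rcases le_or_gt (RN w - κ) 0 with h | h
    · exact ⟨0, hV0, by linarith, Or.inr rfl⟩
    · obtain ⟨q, hq1, hq2⟩ := exists_rat_btwn
        (show max 0 (RN w - 2 * κ) < RN w - κ from max_lt h (by linarith))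
      have := le_max_left 0 (RN w - 2 * κ)
      have := le_max_right 0 (RN w - 2 * κ)
      have := (hRN w).2
      exact ⟨q, hVq q (by linarith) (by linarith), by linarith, Or.inl hq2.le⟩
  choose G hGV hG1 hG2 using hG
  obtain ⟨R, hRV, hRlip, hRge, hRle⟩ := exists_mcshane
    (S := (Fin n → F) ⊕ (Fin n → Option K)) (X := Option F) c hc D D_self D_nonneg D_comm
    D_tri V hV0 hV
    (Sum.elim (fun t j => some (t j)) (fun w j => (w j).map a)) (Sum.elim RF G)
    (by rintro (t | w); exacts [hRF t, hGV w])
  have hsum : ∀ s t : Fin n → Option F, 0 ≤ ∑ j, c j * D (s j) (t j) := fun s t =>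
    Finset.sum_nonneg fun j _ => mul_nonneg (hc j).le (D_nonneg _ _)
  refine ⟨R, hRV, hRlip, fun t => le_antisymm ?_ (hRge (Sum.inl t)), fun w => ?_⟩
  · refine hRle _ _ (hV1 (hRF t)).1 ?_
    rintro (s | w)
    · have := (abs_le.1 (hRFlip s t)).2
      simp only [Sum.elim_inl]
      linarith
    · have := (abs_le.1 (h1 w t)).2
      have := (hV1 (hRF t)).1
      have := hsum (fun j => (w j).map a) (fun j => some (t j))
      simp only [Sum.elim_inr]
      rcases hG2 w with h | h <;> linarith
  · have hlow := hRge (Sum.inr w)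
    simp only [Sum.elim_inr] at hlow
    have hup : R (fun j => (w j).map a) ≤ RN w + κ := by
      have h0 := (hRN w).1
      refine hRle _ _ (by linarith) ?_
      rintro (s | w')
      · have := (abs_le.1 (h1 w s)).1
        simp only [Sum.elim_inl]
        simp only [D_comm (some (s _))]
        linarith
      · have := (abs_le.1 (h2 w' w)).2
        have := hsum (fun j => (w' j).map a) (fun j => (w j).map a)
        simp only [Sum.elim_inr]
        rcases hG2 w' with h | h <;> linarith
    have := hG1 w
    rw [abs_le]; constructor <;> linarith

lemma Sig.Semiproper.abs_sub_le_u_add {L : Sig} (hL : L.Semiproper) (i : L.I) (j : Fin (L.n i))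
    {a b c r s : ℝ} (ha : a ∈ Set.Icc (0 : ℝ) 1) (hc : c ∈ Set.Icc (0 : ℝ) 1) (hr : 0 ≤ r)
    (hs : 0 ≤ s) (hab : |a - b| ≤ L.u i j r) (hbc : |b - c| ≤ L.u i j s) :
    |a - c| ≤ L.u i j (r + s) := by
  rcases lt_or_ge (L.u i j (r + s)) 1 with h | h
  · have h1 : L.u i j r ≤ L.u i j (r + s) :=
      L.u_mono i j hr (add_nonneg hr hs : (0 : ℝ) ≤ _) (by linarith)
    have h2 : L.u i j s ≤ L.u i j (r + s) :=
      L.u_mono i j hs (add_nonneg hr hs : (0 : ℝ) ≤ _) (by linarith)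
    have h3 := hL.2.1 i j r s ⟨hr, h1.trans_lt h⟩ ⟨hs, h2.trans_lt h⟩ ⟨add_nonneg hr hs, h⟩
    have := abs_sub_le a b c
    linarith
  · exact (abs_sub_le_one ha hc).trans h

/-- The distance on `Option X` in which `none` has distance `f y` to `some y`. -/
def optDist {X : Type*} (d : X → X → ℝ) (f : X → ℝ) : Option X → Option X → ℝ
  | none, none => 0
  | none, some y => f y
  | some y, none => f y
  | some y, some z => d y z

section optDist

variable {L : Sig} (F : PreStr L) {f : F.M → ℝ}

lemma optDist_self (x : Option F.M) : optDist F.d f x x = 0 := by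
  cases x with
  | none => rfl
  | some y => exact F.d_self y

lemma optDist_comm (x y : Option F.M) : optDist F.d f x y = optDist F.d f y x := by
  cases x <;> cases y <;> first | rfl | exact F.d_comm _ _

lemma optDist_nonneg (hf : ∀ y, 0 < f y) (x y : Option F.M) : 0 ≤ optDist F.d f x y := by
  cases x <;> cases y <;> first | exact le_rfl | exact (hf _).le | exact F.d_nonneg _ _

lemma optDist_triangle (hf : ∀ y, 0 < f y) (hf1 : ∀ y z, f y ≤ f z + F.d y z)
    (hf2 : ∀ y z, F.d y z ≤ f y + f z) (x y z : Option F.M) :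
    optDist F.d f x z ≤ optDist F.d f x y + optDist F.d f y z := by
  rcases x with - | x <;> rcases y with - | y <;> rcases z with - | z <;> simp only [optDist]
  · simp
  · simp
  · linarith [hf y]
  · linarith [hf1 z y, F.d_comm z y]
  · simp
  · exact hf2 _ _
  · linarith [hf1 x y]
  · exact F.d_triangle _ _ _

end optDist

/-- `x` realizes the type of `pt` up to an error `ε`. -/
structure Realizes {L : Sig} {N U : PreStr L} {K : Type} (pt : Option K → N.M)
    (x : Option K → U.M) (ε : ℝ) : Prop where
  dist_eq : ∀ k l, N.d (pt (some k)) (pt (some l)) = U.d (x (some k)) (x (some l))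
  rel_eq : ∀ i (w : Fin (L.n i) → K),
    N.R i (fun j => pt (some (w j))) = U.R i (fun j => x (some (w j)))
  dist_near : ∀ k, |U.d (x none) (x (some k)) - N.d (pt none) (pt (some k))| ≤ ε
  rel_near : ∀ i (w : Fin (L.n i) → Option K) j,
    |U.R i (fun j => x (w j)) - N.R i (fun j => pt (w j))| ≤ L.u i j ε

/-- Data for extending `F` by one point which realizes the type of `pt`: the points `b`
approximate `x`, and `f` is the distance function generated by the weights `g` at `b`. -/
structure Config {L : Sig} {F N U : PreStr L} {K : Type} (pt : Option K → N.M)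
    (x : Option K → U.M) (b : Option K → F.M) (j : F.M → U.M) (g : Option K → ℝ)
    (f : F.M → ℝ) (ε η : ℝ) : Prop where
  realizes : Realizes pt x ε
  emb : Emb F U j
  base : j (b none) = x none
  near : ∀ k, U.d (x k) (j (b k)) ≤ η
  ε_pos : 0 < ε
  η_pos : 0 < η
  weight_none : ε + 2 * η ≤ g none
  weight_some : ∀ k, N.d (pt none) (pt (some k)) + 2 * η ≤ g (some k)
  f_le : ∀ y k, f y ≤ g k + F.d (b k) y
  f_eq : ∀ y, ∃ k, f y = g k + F.d (b k) y

namespace Config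

variable {L : Sig} {F N U : PreStr L} {K : Type} {pt : Option K → N.M}
  {x : Option K → U.M} {b : Option K → F.M} {e : F.M → U.M} {g : Option K → ℝ}
  {f : F.M → ℝ} {ε η : ℝ}

lemma g_pos (C : Config pt x b e g f ε η) (k : Option K) : 0 < g k := by
  have h1 := C.ε_pos
  have h2 := C.η_pos
  cases k with
  | none => linarith [C.weight_none]
  | some k => linarith [C.weight_some k, N.d_nonneg (pt none) (pt (some k))]

lemma f_pos (C : Config pt x b e g f ε η) (y : F.M) : 0 < f y := by
  obtain ⟨k, hk⟩ := C.f_eq y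
  linarith [C.g_pos k, F.d_nonneg (b k) y]

lemma f_le_add (C : Config pt x b e g f ε η) (y z : F.M) : f y ≤ f z + F.d y z := by
  obtain ⟨k, hk⟩ := C.f_eq z
  linarith [C.f_le y k, F.d_triangle (b k) z y, F.d_comm y z]

lemma dist_b_le (C : Config pt x b e g f ε η) (k l : Option K) :
    F.d (b k) (b l) ≤ U.d (x k) (x l) + 2 * η := by
  rw [← C.emb.2.1]
  linarith [U.d_triangle (e (b k)) (x k) (e (b l)), U.d_triangle (x k) (x l) (e (b l)),
    U.d_comm (e (b k)) (x k), C.near k, C.near l]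

lemma dist_x_le (C : Config pt x b e g f ε η) (k l : Option K) :
    U.d (x k) (x l) ≤ F.d (b k) (b l) + 2 * η := by
  rw [← C.emb.2.1]
  linarith [U.d_triangle (x k) (e (b k)) (x l), U.d_triangle (e (b k)) (e (b l)) (x l),
    U.d_comm (e (b l)) (x l), C.near k, C.near l]

lemma dist_b_le_g (C : Config pt x b e g f ε η) (k l : Option K) :
    F.d (b k) (b l) ≤ g k + g l := by
  have h1 := C.dist_b_le k l
  have h2 := C.g_pos k
  have h3 := C.g_pos l
  rcases k with - | k <;> rcases l with - | l
  · rw [F.d_self]; linarith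
  · linarith [C.weight_none, C.weight_some l, (abs_le.1 (C.realizes.dist_near l)).2, C.η_pos]
  · linarith [C.weight_none, C.weight_some k, (abs_le.1 (C.realizes.dist_near k)).2, C.η_pos,
      U.d_comm (x (some k)) (x none)]
  · linarith [C.weight_some l, C.weight_some k, C.realizes.dist_eq k l, C.η_pos,
      N.d_triangle (pt (some k)) (pt none) (pt (some l)), N.d_comm (pt (some k)) (pt none)]

lemma dist_le_f_add_f (C : Config pt x b e g f ε η) (y z : F.M) : F.d y z ≤ f y + f z := by
  obtain ⟨k, hk⟩ := C.f_eq y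
  obtain ⟨l, hl⟩ := C.f_eq z
  linarith [C.dist_b_le_g k l, F.d_triangle y (b k) z, F.d_triangle (b k) (b l) z,
    F.d_comm y (b k)]

lemma dist_pt_le_f (C : Config pt x b e g f ε η) (k : K) :
    N.d (pt none) (pt (some k)) ≤ f (b (some k)) + 2 * η := by
  obtain ⟨l, hl⟩ := C.f_eq (b (some k))
  have h := C.dist_x_le l (some k)
  have hη := C.η_pos
  rcases l with - | l
  · linarith [C.weight_none, (abs_le.1 (C.realizes.dist_near k)).1]
  · linarith [C.weight_some l, C.realizes.dist_eq l k,
      N.d_triangle (pt none) (pt (some l)) (pt (some k))]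

lemma dist_pt_le (C : Config pt x b e g f ε η) (k l : Option K) :
    N.d (pt k) (pt l) ≤
      optDist F.d f (k.map fun k => b (some k)) (l.map fun k => b (some k)) + 2 * η := by
  have hη := C.η_pos
  rcases k with - | k <;> rcases l with - | l <;> simp only [Option.map, optDist]
  · rw [N.d_self]; linarith
  · exact C.dist_pt_le_f l
  · rw [N.d_comm]; exact C.dist_pt_le_f k
  · rw [C.realizes.dist_eq]; exact C.dist_x_le _ _

/-- A distance to a point of `F` is realized by passing through one of the points `b`. -/
lemma exists_through (C : Config pt x b e g f ε η) (k : Option K) (y : F.M) :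
    ∃ (l : Option K) (γ : ℝ), N.d (pt k) (pt l) + (l.elim ε fun _ => 0) ≤ γ ∧
      optDist F.d f (k.map fun k => b (some k)) (some y) = γ + F.d (b l) y := by
  have hη := C.η_pos
  rcases k with - | k
  · obtain ⟨l, hl⟩ := C.f_eq y
    refine ⟨l, g l, ?_, hl⟩
    rcases l with - | l
    · simp only [Option.elim, N.d_self]; linarith [C.weight_none]
    · simp only [Option.elim]; linarith [C.weight_some l]
  · exact ⟨some k, 0, by simp [N.d_self], by simp [optDist]⟩

end Config

/-- The relation `i` extends from `F` to a new point, approximately as prescribed by `pt`. -/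
def RelExtends {L : Sig} (F N : PreStr L) {K : Type} (pt : Option K → N.M)
    (b : Option K → F.M) (f : F.M → ℝ) (V : Set ℝ) (i : L.I) (κ : ℝ) : Prop :=
  ∃ R : (Fin (L.n i) → Option F.M) → ℝ, (∀ t, R t ∈ V) ∧
    (∀ j s t, (∀ k, k ≠ j → s k = t k) → |R s - R t| ≤ L.u i j (optDist F.d f (s j) (t j))) ∧
    (∀ t : Fin (L.n i) → F.M, R (fun j => some (t j)) = F.R i t) ∧
    ∀ w : Fin (L.n i) → Option K,
      |R (fun j => (w j).map fun k => b (some k)) - N.R i (fun j => pt (w j))| ≤ 2 * κ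

namespace Config

variable {L : Sig} {F N U : PreStr L} {K : Type} {pt : Option K → N.M}
  {x : Option K → U.M} {b : Option K → F.M} {e : F.M → U.M} {g : Option K → ℝ}
  {f : F.M → ℝ} {ε η : ℝ}

lemma relExtends_of_linear (C : Config pt x b e g f ε η) [Finite F.M] [Finite K]
    (Δ V : Set ℝ) (hgood : GoodPair L Δ V)
    (hVq : ∀ q : ℚ, 0 ≤ (q : ℝ) → (q : ℝ) ≤ 1 → (q : ℝ) ∈ V) (hF : Valued Δ V F)
    (hf : ∀ y, f y ∈ Δ) {i : L.I} {c : Fin (L.n i) → ℝ} (hc : LinearModulus L i c) {κ : ℝ}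
    (hκ : 0 < κ) (hη : ∑ j, c j * (2 * η) ≤ κ) : RelExtends F N pt b f V i κ := by
  have hη0 := C.η_pos
  obtain ⟨-, hV1, -, hV0, hVsub⟩ := hgood
  have hD0 := optDist_nonneg F C.f_pos
  have hVc : ∀ v ∈ V, ∀ j (s t : Option F.M), 0 < v - c j * optDist F.d f s t →
      v - c j * optDist F.d f s t ∈ V := by
    intro v hv j s t h
    have hmem : optDist F.d f s t = 0 ∨ optDist F.d f s t ∈ Δ := by
      rcases s with - | s <;> rcases t with - | t
      · exact Or.inl rfl
      · exact Or.inr (hf t)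
      · exact Or.inr (hf s)
      · by_cases hst : s = t
        · subst hst; exact Or.inl (F.d_self s)
        · exact Or.inr (hF.1 s t hst)
    rcases hmem with h0 | h0
    · simpa [h0] using hv
    · have hlt : L.u i j (optDist F.d f s t) < 1 := by
        by_contra hcon
        have := (hc j).2.2 _ (hD0 s t) (not_lt.1 hcon)
        linarith [(hV1 hv).2]
      have heq := (hc j).2.1 _ (hD0 s t) hlt
      rw [← heq] at h ⊢
      exact hVsub v hv _ h0 i j (by linarith)
  have h1 : ∀ (w : Fin (L.n i) → Option K) (t : Fin (L.n i) → F.M),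
      |(N.R i fun j => pt (w j)) - F.R i t| ≤
        ∑ j, c j * optDist F.d f ((w j).map fun k => b (some k)) (some (t j)) + κ := by
    intro w t
    choose l γ hl hγ using fun j => C.exists_through (w j) (t j)
    have h1 := hc.abs_R_sub_le N (fun j => pt (w j)) (fun j => pt (l j))
    have h2 : |U.R i (fun j => x (l j)) - N.R i (fun j => pt (l j))| ≤
        ∑ j, c j * (l j).elim ε fun _ => 0 := by
      have hnn : ∀ j ∈ Finset.univ, 0 ≤ c j * (l j).elim ε fun _ => 0 := fun j _ =>
        mul_nonneg (hc j).1.le (by cases l j <;> simp [C.ε_pos.le])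
      by_cases hex : ∃ j, l j = none
      · obtain ⟨j, hj⟩ := hex
        have := hc.le_mul j C.ε_pos.le (abs_sub_le_one (U.R_mem i fun j => x (l j))
          (N.R_mem i fun j => pt (l j))) (C.realizes.rel_near i l j)
        refine this.trans ((le_of_eq ?_).trans (Finset.single_le_sum hnn (Finset.mem_univ j)))
        simp [hj]
      · push Not at hex
        choose m hm using fun j => Option.ne_none_iff_exists'.1 (hex j)
        simp only [hm]
        rw [C.realizes.rel_eq i m]
        simp
    have h3 := hc.abs_R_sub_le U (fun j => x (l j)) (fun j => e (b (l j)))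
    have h4 := hc.abs_R_sub_le F (fun j => b (l j)) t
    have h5 : U.R i (fun j => e (b (l j))) = F.R i fun j => b (l j) := C.emb.2.2 i fun j => b (l j)
    have h6 : ∑ j, c j * U.d (x (l j)) (e (b (l j))) ≤ ∑ j, c j * (2 * η) :=
      Finset.sum_le_sum fun j _ => mul_le_mul_of_nonneg_left
        (by linarith [C.near (l j)]) (hc j).1.le
    have h7 : ∑ j, c j * N.d (pt (w j)) (pt (l j)) + ∑ j, c j * ((l j).elim ε fun _ => 0) +
        ∑ j, c j * F.d (b (l j)) (t j) ≤
        ∑ j, c j * optDist F.d f ((w j).map fun k => b (some k)) (some (t j)) := by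
      rw [← Finset.sum_add_distrib, ← Finset.sum_add_distrib]
      refine Finset.sum_le_sum fun j _ => ?_
      rw [hγ j, ← mul_add, ← mul_add]
      exact mul_le_mul_of_nonneg_left (by linarith [hl j]) (hc j).1.le
    rw [h5] at h3
    rw [abs_le] at h1 h2 h3 h4 ⊢
    constructor <;> linarith
  have h2 : ∀ w w' : Fin (L.n i) → Option K,
      |(N.R i fun j => pt (w j)) - N.R i fun j => pt (w' j)| ≤
        ∑ j, c j * optDist F.d f ((w j).map fun k => b (some k))
          ((w' j).map fun k => b (some k)) + κ := by
    intro w w'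
    refine (hc.abs_R_sub_le N _ _).trans (le_trans ?_ (add_le_add_right hη _))
    rw [← Finset.sum_add_distrib]
    refine Finset.sum_le_sum fun j _ => ?_
    rw [← mul_add]
    exact mul_le_mul_of_nonneg_left (C.dist_pt_le _ _) (hc j).1.le
  obtain ⟨R, hR1, hR2, hR3, hR4⟩ := exists_lipschitz_amalgam c (fun j => (hc j).1)
    (optDist F.d f) (optDist_self F) hD0 (optDist_comm F)
    (optDist_triangle F C.f_pos C.f_le_add C.dist_le_f_add_f) V hV0 hV1 hVq hVc (F.R i)
    (fun t => hF.2 i t) (fun s t => hc.abs_R_sub_le F s t) (fun k => b (some k))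
    (fun w => N.R i fun j => pt (w j)) (fun w => N.R_mem i _) κ hκ h1 h2
  refine ⟨R, hR1, fun j s t hst => ?_, hR3, hR4⟩
  refine hc.le_u j (hD0 _ _) (abs_sub_le_one (hV1 (hR1 s)) (hV1 (hR1 t))) ((hR2 s t).trans ?_)
  refine (Finset.sum_eq_single j (fun k _ hk => ?_) (by simp)).le
  rw [hst k hk, optDist_self, mul_zero]

lemma relExtends_of_unary (C : Config pt x b e g f ε η) (hL : L.Semiproper)
    (Δ V : Set ℝ) (hV1 : V ⊆ Set.Icc 0 1)
    (hVq : ∀ q : ℚ, 0 ≤ (q : ℝ) → (q : ℝ) ≤ 1 → (q : ℝ) ∈ V) (hF : Valued Δ V F)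
    {i : L.I} (hn : L.n i = 1) {κ : ℝ} (hκ : 0 < κ) (hη : ∀ j, L.u i j η ≤ κ) :
    RelExtends F N pt b f V i κ := by
  have hη0 := C.η_pos
  obtain ⟨j₀, hj₀⟩ : ∃ j₀ : Fin (L.n i), ∀ j, j = j₀ :=
    ⟨⟨0, by omega⟩, fun j => Fin.ext (by have := j.2; simp only; omega)⟩
  have hconst : ∀ {X : Type} (t : Fin (L.n i) → X), t = fun _ => t j₀ := fun t =>
    funext fun j => by rw [hj₀ j]
  obtain ⟨r, hrV, hr⟩ : ∃ r ∈ V, |r - N.R i fun _ => pt none| ≤ L.u i j₀ η := by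
    have hu := L.u_pos i j₀ η hη0
    obtain ⟨h0, h1⟩ := N.R_mem i fun _ => pt none
    rcases h0.eq_or_lt with h | h
    · exact ⟨0, by simpa using hVq 0 (by simp) (by simp), by simp [← h, hu.le]⟩
    · obtain ⟨q, hq1, hq2⟩ := exists_rat_btwn
        (show max 0 ((N.R i fun _ => pt none) - L.u i j₀ η) < N.R i fun _ => pt none from
          max_lt h (by linarith))
      have := le_max_left 0 ((N.R i fun _ => pt none) - L.u i j₀ η)
      have := le_max_right 0 ((N.R i fun _ => pt none) - L.u i j₀ η)
      refine ⟨q, hVq q (by linarith) (by linarith), ?_⟩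
      rw [abs_le]; constructor <;> linarith
  have hrF : ∀ y, |r - F.R i fun _ => y| ≤ L.u i j₀ (f y) := by
    intro y
    obtain ⟨k, hk⟩ := C.f_eq y
    have hby : |(F.R i fun _ => b k) - F.R i fun _ => y| ≤ L.u i j₀ (F.d (b k) y) :=
      F.R_uc i j₀ (fun _ => b k) (fun _ => y) (fun k hk => absurd (hj₀ k) hk)
    have hxb : |(U.R i fun _ => x k) - F.R i fun _ => b k| ≤ L.u i j₀ η := by
      have h : U.R i (fun _ => e (b k)) = F.R i fun _ => b k := C.emb.2.2 i fun _ => b k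
      rw [← h]
      exact (U.R_uc i j₀ (fun _ => x k) (fun _ => e (b k))
        (fun k hk => absurd (hj₀ k) hk)).trans (L.u_mono i j₀ (U.d_nonneg _ _) hη0.le (C.near k))
    have hNx : ∃ δ, 0 ≤ δ ∧ |(N.R i fun _ => pt none) - U.R i fun _ => x k| ≤ L.u i j₀ δ ∧
        δ + 2 * η ≤ g k := by
      rcases k with - | k
      · refine ⟨ε, C.ε_pos.le, ?_, C.weight_none⟩
        rw [abs_sub_comm]
        exact C.realizes.rel_near i (fun _ => none) j₀
      · refine ⟨_, N.d_nonneg _ _, ?_, C.weight_some k⟩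
        have := C.realizes.rel_eq i fun _ => k
        rw [← this]
        exact N.R_uc i j₀ (fun _ => pt none) (fun _ => pt (some k))
          (fun k hk => absurd (hj₀ k) hk)
    obtain ⟨δ, hδ, hNx, hg⟩ := hNx
    have hd := F.d_nonneg (b k) y
    have h1 := hL.abs_sub_le_u_add i j₀ (hV1 hrV) (U.R_mem i _) hη0.le hδ hr hNx
    have h2 := hL.abs_sub_le_u_add i j₀ (hV1 hrV) (F.R_mem i _) (by positivity) hη0.le h1 hxb
    have h3 := hL.abs_sub_le_u_add i j₀ (hV1 hrV) (F.R_mem i _) (by positivity) hd h2 hby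
    refine h3.trans (L.u_mono i j₀ ?_ (C.f_pos y).le (by linarith))
    have : 0 ≤ η + δ + η + F.d (b k) y := by positivity
    exact this
  obtain ⟨R, hRnone, hRsome⟩ : ∃ R : Option F.M → ℝ, R none = r ∧
      ∀ y, R (some y) = F.R i fun _ => y :=
    ⟨fun o => o.elim r fun y => F.R i fun _ => y, rfl, fun _ => rfl⟩
  refine ⟨fun t => R (t j₀), fun t => ?_, fun j s t _ => ?_, fun t => ?_, fun w => ?_⟩
  · dsimp only
    rcases t j₀ with - | y
    · rw [hRnone]; exact hrV
    · rw [hRsome]; exact hF.2 i _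
  · rw [hj₀ j]
    dsimp only
    rcases s j₀ with - | y <;> rcases t j₀ with - | z <;>
      simp only [hRnone, hRsome, optDist]
    · simp [L.u_zero]
    · exact hrF z
    · rw [abs_sub_comm]; exact hrF y
    · exact F.R_uc i j₀ (fun _ => y) (fun _ => z) (fun k hk => absurd (hj₀ k) hk)
  · dsimp only
    rw [hRsome, ← hconst t]
  · rw [hconst fun j => pt (w j)]
    dsimp only
    rcases w j₀ with - | k <;> simp only [Option.map, hRnone, hRsome]
    · linarith [hη j₀]
    · have h : U.R i (fun _ => e (b (some k))) = F.R i fun _ => b (some k) :=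
        C.emb.2.2 i fun _ => b (some k)
      rw [← h, C.realizes.rel_eq i fun _ => k, abs_sub_comm]
      have := (U.R_uc i j₀ (fun _ => x (some k)) (fun _ => e (b (some k)))
        (fun k hk => absurd (hj₀ k) hk)).trans
        (L.u_mono i j₀ (U.d_nonneg _ _) hη0.le (C.near (some k)))
      linarith [hη j₀]

end Config

/-- The substructure of `A` on a set of points. -/
abbrev PreStr.sub {L : Sig} (A : PreStr L) (S : Set A.M) : PreStr L where
  M := S
  d x y := A.d x y
  d_self x := A.d_self x
  d_eq_zero _ _ h := Subtype.ext (A.d_eq_zero _ _ h)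
  d_comm x y := A.d_comm x y
  d_triangle x y z := A.d_triangle x y z
  R i x := A.R i fun j => x j
  R_mem i _ := A.R_mem i _
  R_uc i j _ _ h := A.R_uc i j _ _ fun k hk => congrArg Subtype.val (h k hk)

lemma PreStr.emb_sub {L : Sig} (A : PreStr L) (S : Set A.M) :
    Emb (A.sub S) A Subtype.val :=
  emb_of_dist (fun _ _ => rfl) fun _ _ => rfl

lemma PreStr.valued_sub {L : Sig} {A : PreStr L} {Δ V : Set ℝ} (hA : Valued Δ V A)
    (S : Set A.M) : Valued Δ V (A.sub S) :=
  ⟨fun x y h => hA.1 x.1 y.1 fun h' => h (Subtype.ext h'), fun i _ => hA.2 i _⟩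

/-- The extension of `F` by the point `none`. -/
abbrev PreStr.adjoin {L : Sig} (F : PreStr L) (f : F.M → ℝ) (hf0 : ∀ y, 0 < f y)
    (hf1 : ∀ y z, f y ≤ f z + F.d y z) (hf2 : ∀ y z, F.d y z ≤ f y + f z)
    (R : (i : L.I) → (Fin (L.n i) → Option F.M) → ℝ) (hR : ∀ i t, R i t ∈ Set.Icc (0 : ℝ) 1)
    (hRu : ∀ i j s t, (∀ k, k ≠ j → s k = t k) →
      |R i s - R i t| ≤ L.u i j (optDist F.d f (s j) (t j))) : PreStr L where
  M := Option F.M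
  d := optDist F.d f
  d_self := optDist_self F
  d_eq_zero x y h := by
    rcases x with - | x <;> rcases y with - | y
    · rfl
    · exact absurd h (hf0 y).ne'
    · exact absurd h (hf0 x).ne'
    · exact congrArg some (F.d_eq_zero x y h)
  d_comm := optDist_comm F
  d_triangle := optDist_triangle F hf0 hf1 hf2
  R := R
  R_mem := hR
  R_uc := hRu

lemma HasUrysohnRel.exists_point {L : Sig} {Δ V : Set ℝ} {A : PreStr L} (hV : V ⊆ Set.Icc 0 1)
    (hA : HasUrysohnRel Δ V A) (hAval : Valued Δ V A) (S : Set A.M) [Finite (A.sub S).M]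
    (f : (A.sub S).M → ℝ) (hfΔ : ∀ y, f y ∈ Δ) (hf0 : ∀ y, 0 < f y)
    (hf1 : ∀ y z, f y ≤ f z + (A.sub S).d y z) (hf2 : ∀ y z, (A.sub S).d y z ≤ f y + f z)
    (R : (i : L.I) → (Fin (L.n i) → Option (A.sub S).M) → ℝ) (hR : ∀ i t, R i t ∈ V)
    (hRu : ∀ i j s t, (∀ k, k ≠ j → s k = t k) →
      |R i s - R i t| ≤ L.u i j (optDist (A.sub S).d f (s j) (t j)))
    (hRe : ∀ i (t : Fin (L.n i) → (A.sub S).M),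
      R i (fun j => some (t j)) = (A.sub S).R i t) :
    ∃ q : A.M, (∀ y : (A.sub S).M, A.d q y.1 = f y) ∧
      ∀ i (t : Fin (L.n i) → Option (A.sub S).M),
        A.R i (fun j => (t j).elim q Subtype.val) = R i t := by
  have hval : Valued Δ V
      ((A.sub S).adjoin f hf0 hf1 hf2 R (fun i t => hV (hR i t)) hRu) := by
    refine ⟨fun x y h => ?_, hR⟩
    rcases x with - | x <;> rcases y with - | y
    · exact absurd rfl h
    · exact hfΔ y
    · exact hfΔ x
    · exact hAval.1 x.1 y.1 fun h' => h (congrArg some (Subtype.ext h'))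
  have hext : OnePointExt (A.sub S)
      ((A.sub S).adjoin f hf0 hf1 hf2 R (fun i t => hV (hR i t)) hRu) some := by
    refine ⟨emb_of_dist (fun _ _ => rfl) fun i t => hRe i t, none, ?_, fun y => ?_⟩
    · rintro ⟨y, hy⟩
      cases hy
    · rcases y with - | y
      · exact Or.inr rfl
      · exact Or.inl ⟨y, rfl⟩
  obtain ⟨ψ, hψ, hψe⟩ := hA (A.sub S) _ some inferInstance (A.valued_sub hAval S) hval hext
    Subtype.val (A.emb_sub S)
  have hsome : ∀ y, ψ (some y) = y.1 := fun y => congrFun hψe y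
  refine ⟨ψ none, fun y => ?_, fun i t => ?_⟩
  · rw [← hsome y]
    exact hψ.2.1 none (some y)
  · refine Eq.trans ?_ (hψ.2.2 i t)
    congr 1
    funext j
    change (t j).elim (ψ none) Subtype.val = ψ (t j)
    generalize t j = o
    rcases o with - | y
    · rfl
    · exact (hsome y).symm

lemma HasUrysohnRel.exists_emb {L : Sig} {Δ V : Set ℝ} {A : PreStr L}
    (hA : HasUrysohnRel Δ V A) (P : PreStr L) [Finite P.M] (hP : Valued Δ V P) :
    ∃ ψ : P.M → A.M, Emb P A ψ := by
  suffices H : ∀ S : Set P.M, ∃ ψ : (P.sub S).M → A.M, Emb (P.sub S) A ψ by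
    obtain ⟨ψ, hψ⟩ := H Set.univ
    exact ⟨fun x => ψ ⟨x, trivial⟩, emb_of_dist (fun x y => hψ.2.1 _ _)
      fun i x => hψ.2.2 i fun j => ⟨x j, trivial⟩⟩
  intro S
  induction S, S.toFinite using Set.Finite.induction_on with
  | empty =>
    refine ⟨fun x => x.2.elim, emb_of_dist (fun x => x.2.elim) fun i x => ?_⟩
    exact (x ⟨0, L.n_pos i⟩).2.elim
  | @insert a S ha hS ih =>
    obtain ⟨φ, hφ⟩ := ih
    have hext : OnePointExt (P.sub S) (P.sub (insert a S))
        (Set.inclusion (Set.subset_insert a S)) := by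
      refine ⟨emb_of_dist (fun _ _ => rfl) fun _ _ => rfl, ⟨a, Set.mem_insert a S⟩, ?_, ?_⟩
      · rintro ⟨y, hy⟩
        exact ha ((show y.1 = a from congrArg Subtype.val hy) ▸ y.2)
      · rintro ⟨y, rfl | hy⟩
        · exact Or.inr rfl
        · exact Or.inl ⟨⟨y, hy⟩, rfl⟩
    obtain ⟨ψ, hψ, -⟩ := hA _ _ _ Subtype.finite (P.valued_sub hP S) (P.valued_sub hP _) hext φ hφ
    exact ⟨ψ, hψ⟩

/-- The metric on three points, two at distance `r` and the third at distance `D` from both. -/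
def triDist (r D : ℝ) (x y : Fin 3) : ℝ :=
  if x = y then 0 else if x = 2 ∨ y = 2 then D else r

lemma triDist_comm (r D : ℝ) (x y : Fin 3) : triDist r D x y = triDist r D y x := by
  fin_cases x <;> fin_cases y <;> simp [triDist]

/-- The structure with metric `triDist r D` whose relations are indicator functions. -/
noncomputable abbrev triangle (L : Sig) (r D : ℝ) (hr : 0 < r) (hD : 0 < D) (hrD : r ≤ 2 * D)
    (T : (i : L.I) → Set (Fin (L.n i) → Fin 3))
    (hT : ∀ i j, ∀ x ∈ T i, ∀ y ∉ T i, (∀ k, k ≠ j → x k = y k) →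
      1 ≤ L.u i j (triDist r D (x j) (y j))) : PreStr L where
  M := Fin 3
  d := triDist r D
  d_self x := if_pos rfl
  d_eq_zero x y h := by
    by_contra hxy
    rw [triDist, if_neg hxy] at h
    split_ifs at h <;> linarith
  d_comm := triDist_comm r D
  d_triangle x y z := by
    fin_cases x <;> fin_cases y <;> fin_cases z <;> simp [triDist] <;> linarith
  R i := (T i).indicator 1
  R_mem i x := by
    by_cases h : x ∈ T i <;> simp [h]
  R_uc i j x y h := by
    by_cases hx : x ∈ T i <;> by_cases hy : y ∈ T i
    · simpa [hx, hy] using L.u_nonneg i j _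
    · simpa [hx, hy] using hT i j x hx y hy h
    · rw [triDist_comm]
      simpa [hx, hy] using hT i j y hy x hx fun k hk => (h k hk).symm
    · simpa [hx, hy] using L.u_nonneg i j _

lemma valued_triangle {L : Sig} {r D : ℝ} {hr : 0 < r} {hD : 0 < D} {hrD : r ≤ 2 * D} {T hT}
    {Δ V : Set ℝ} (hrΔ : r ∈ Δ) (hDΔ : D ∈ Δ) (h0 : (0 : ℝ) ∈ V) (h1 : (1 : ℝ) ∈ V) :
    Valued Δ V (triangle L r D hr hD hrD T hT) := by
  refine ⟨fun (x y : Fin 3) h => ?_, fun i x => ?_⟩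
  · change triDist r D x y ∈ Δ
    rw [triDist, if_neg h]
    split_ifs <;> assumption
  · change (T i).indicator 1 x ∈ V
    by_cases h : x ∈ T i <;> simpa [h]

lemma Sig.Semiproper.eventually_one_le {L : Sig} (hL : L.Semiproper) (i : L.I)
    (j : Fin (L.n i)) : ∀ᶠ r in Filter.atTop, 1 ≤ L.u i j r := by
  obtain ⟨B, hB⟩ := hL.1 i j
  filter_upwards [Filter.eventually_gt_atTop B, Filter.eventually_ge_atTop 0] with r hr hr0
  by_contra h
  exact absurd (hB ⟨hr0, not_le.1 h⟩) (not_le.2 hr)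

/-- Amalgamating two three-point structures over a two-point one shows that a modulus of a
relation of arity at least two cannot jump to `1`. -/
lemma one_le_two_mul_u_half {L : Sig} (hL : L.Semiproper) {Δ V : Set ℝ}
    (hΔ : Δ = {x : ℝ | 0 < x ∧ ∃ q : ℚ, x = (q : ℝ)}) (h0 : (0 : ℝ) ∈ V) (h1 : (1 : ℝ) ∈ V)
    {A : PreStr L} (hA : HasUrysohnRel Δ V A) {i : L.I} (hi : 2 ≤ L.n i) (j : Fin (L.n i))
    {r : ℝ} (hr : r ∈ Δ) (hru : 1 ≤ L.u i j r) : 1 ≤ 2 * L.u i j (r / 2) := by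
  have hr' := hr
  rw [hΔ] at hr'
  obtain ⟨hr0, qr, hqr⟩ := hr'
  have hr2 : r / 2 ∈ Δ := by
    rw [hΔ]
    exact ⟨by positivity, qr / 2, by rw [hqr]; push_cast; rfl⟩
  obtain ⟨D, hDu, hDr, hD0⟩ : ∃ D : ℕ, (∀ k, 1 ≤ L.u i k (D : ℝ)) ∧ r ≤ D ∧ (0 : ℝ) < D :=
    (tendsto_natCast_atTop_atTop.eventually
      ((Filter.eventually_all.2 fun k => hL.eventually_one_le i k).and
        ((Filter.eventually_ge_atTop r).and (Filter.eventually_gt_atTop 0)))).exists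
  have hDΔ : (D : ℝ) ∈ Δ := by
    rw [hΔ]
    exact ⟨hD0, D, by simp⟩
  obtain ⟨l, hl⟩ : ∃ l, l ≠ j := by
    have : Nontrivial (Fin (L.n i)) := Fin.nontrivial_iff_two_le.2 hi
    exact exists_ne j
  let t₀ : Fin 3 → Fin (L.n i) → Fin 3 := fun z k => if k = j then z else 2
  let T : (i : L.I) → Set (Fin (L.n i) → Fin 3) := fun i' =>
    {t | (⟨i', t⟩ : Σ i, Fin (L.n i) → Fin 3) = ⟨i, t₀ 1⟩}
  have hT : ∀ i j, ∀ x ∈ T i, ∀ y ∉ T i, (∀ k, k ≠ j → x k = y k) →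
      1 ≤ L.u i j (triDist r D (x j) (y j)) := by
    intro i' j' x hx y hy hxy
    obtain ⟨rfl, hx⟩ := Sigma.mk.inj_iff.1 hx
    obtain rfl := eq_of_heq hx
    have hne : t₀ 1 j' ≠ y j' := by
      intro h
      refine hy ?_
      have : y = t₀ 1 := funext fun k => by
        by_cases hk : k = j'
        · rw [hk, h]
        · exact (hxy k hk).symm
      rw [this]
      rfl
    rw [triDist, if_neg hne]
    by_cases hj : j' = j
    · subst hj
      split_ifs
      · exact hDu _
      · exact hru
    · rw [if_pos (Or.inl (if_neg hj))]
      exact hDu _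
  let P := triangle L r D hr0 hD0 (by linarith) T hT
  let Q := triangle L r (r / 2) hr0 (by positivity) (by linarith) (fun _ => ∅) (by simp)
  have : Finite P.M := inferInstanceAs (Finite (Fin 3))
  have hP : Valued Δ V P := valued_triangle hr hDΔ h0 h1
  have hQ : Valued Δ V Q := valued_triangle hr hr2 h0 h1
  obtain ⟨ψ, hψ⟩ := hA.exists_emb P hP
  let S : Set P.M := {x : Fin 3 | x ≠ 2}
  have hext : ∀ (B : PreStr L) (v : (P.sub S).M → Fin 3), v = Subtype.val →
      (∃ z : Fin 3, z ∉ Set.range v ∧ ∀ y : Fin 3, y ∈ Set.range v ∨ y = z) := by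
    rintro B _ rfl
    refine ⟨2, by rintro ⟨x, hx⟩; exact x.2 hx, fun y => ?_⟩
    by_cases hy : y = 2
    · exact Or.inr hy
    · exact Or.inl ⟨⟨y, hy⟩, rfl⟩
  have hSQ : Emb (P.sub S) Q Subtype.val := by
    refine emb_of_dist (fun x y => ?_) fun i' x => ?_
    · have hx : x.1 ≠ (2 : Fin 3) := x.2
      have hy : y.1 ≠ (2 : Fin 3) := y.2
      change triDist r (r / 2) x.1 y.1 = triDist r D x.1 y.1
      rw [triDist, triDist, if_neg (not_or.2 ⟨hx, hy⟩), if_neg (not_or.2 ⟨hx, hy⟩)]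
    · change Set.indicator ∅ (1 : (Fin (L.n i') → Fin 3) → ℝ) _ =
        Set.indicator (T i') 1 fun j => (x j).1
      rw [Set.indicator_empty, Set.indicator_of_notMem]
      intro h
      obtain ⟨rfl, h⟩ := Sigma.mk.inj_iff.1 h
      have := congrFun (eq_of_heq h) l
      exact (x l).2 (this.trans (if_neg hl))
  obtain ⟨ψ', hψ', hcomp⟩ := hA (P.sub S) Q Subtype.val Subtype.finite (P.valued_sub hP S) hQ
    ⟨hSQ, hext Q _ rfl⟩ (ψ ∘ Subtype.val)
    (emb_of_dist (fun x y => hψ.2.1 _ _) fun i x => hψ.2.2 i _)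
  have hval : ∀ z : Fin 3, z ≠ 2 → ψ' z = ψ z := fun z hz => congrFun hcomp ⟨z, hz⟩
  have hd : ∀ z : Fin 3, z ≠ 2 → A.d (ψ z) (ψ' (2 : Fin 3)) = r / 2 := by
    intro z hz
    rw [← hval z hz]
    refine (hψ'.2.1 z (2 : Fin 3)).trans ?_
    change triDist r (r / 2) z 2 = r / 2
    rw [triDist, if_neg hz, if_pos (Or.inr rfl)]
  have hRT : ∀ z : Fin 3, A.R i (fun k => if k = j then ψ z else ψ (2 : Fin 3)) =
      Set.indicator (T i) 1 (t₀ z) := by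
    intro z
    refine Eq.trans ?_ (hψ.2.2 i (t₀ z))
    congr 1
    funext k
    simp only [Function.comp, t₀]
    split_ifs <;> rfl
  have hR1 := hRT 1
  have hR0 := hRT 0
  rw [Set.indicator_of_mem (show t₀ 1 ∈ T i from rfl)] at hR1
  rw [Set.indicator_of_notMem] at hR0
  · have key : ∀ z : Fin 3, z ≠ 2 → |A.R i (fun k => if k = j then ψ z else ψ (2 : Fin 3)) -
        A.R i (fun k => if k = j then ψ' (2 : Fin 3) else ψ (2 : Fin 3))| ≤ L.u i j (r / 2) := by
      intro z hz
      have := A.R_uc i j (fun k => if k = j then ψ z else ψ (2 : Fin 3))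
        (fun k => if k = j then ψ' (2 : Fin 3) else ψ (2 : Fin 3))
        (fun k hk => by simp only [if_neg hk])
      simpa only [if_true, hd z hz] using this
    have k1 := (abs_le.1 (key 1 (by decide))).2
    have k0 := (abs_le.1 (key 0 (by decide))).1
    rw [hR1] at k1
    rw [hR0] at k0
    simp only [Pi.one_apply] at k1
    linarith
  · intro h
    have := congrFun (eq_of_heq (Sigma.mk.inj_iff.1 h).2) j
    simp [t₀] at this

lemma Sig.eventually_u_lt (L : Sig) (i : L.I) (j : Fin (L.n i)) {δ : ℝ} (hδ : 0 < δ) :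
    ∀ᶠ r in nhdsWithin 0 (Set.Ioi 0), L.u i j r < δ :=
  (L.u_lim i j).eventually (gt_mem_nhds hδ)

lemma Sig.eventually_sum_u_lt (L : Sig) (i : L.I) {δ : ℝ} (hδ : 0 < δ) :
    ∀ᶠ r in nhdsWithin 0 (Set.Ioi 0), ∑ j, L.u i j r < δ := by
  have h := tendsto_finsetSum (Finset.univ : Finset (Fin (L.n i))) fun j _ => L.u_lim i j
  rw [Finset.sum_const_zero] at h
  exact h.eventually (gt_mem_nhds hδ)

lemma exists_linearModulus {L : Sig} (hL : L.Semiproper) {Δ V : Set ℝ}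
    (hΔ : Δ = {x : ℝ | 0 < x ∧ ∃ q : ℚ, x = (q : ℝ)}) (h0 : (0 : ℝ) ∈ V) (h1 : (1 : ℝ) ∈ V)
    {A : PreStr L} (hA : HasUrysohnRel Δ V A) {i : L.I} (hi : 2 ≤ L.n i) :
    ∃ c, LinearModulus L i c := by
  choose c hc0 hc using hL.2.2 i hi
  refine ⟨c, fun j => ⟨hc0 j, fun r hr hu => hc j r ⟨hr, hu⟩, fun r hr hu => ?_⟩⟩
  by_contra! hcr
  set B : Set ℝ := {s | 0 ≤ s ∧ 1 ≤ L.u i j s}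
  have hBr : r ∈ B := ⟨hr, hu⟩
  have hBb : BddBelow B := ⟨0, fun s hs => hs.1⟩
  obtain ⟨δ, hδ, hδu⟩ := mem_nhdsGT_iff_exists_Ioo_subset.1 (L.eventually_u_lt i j one_pos)
  have hb0 : 0 < sInf B := by
    refine lt_of_lt_of_le hδ (le_csInf ⟨r, hBr⟩ fun s hs => ?_)
    by_contra! hsδ
    rcases hs.1.eq_or_lt with h | h
    · have := hs.2
      rw [← h, L.u_zero] at this
      linarith
    · have h2 : L.u i j s < 1 := hδu ⟨h, hsδ⟩
      linarith [hs.2]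
  have hbr : sInf B ≤ r := csInf_le hBb hBr
  have hbc : sInf B < 1 / c j := hbr.trans_lt (by rw [lt_div_iff₀ (hc0 j)]; linarith)
  obtain ⟨q, hq1, hq2⟩ := exists_rat_btwn (show sInf B < min (2 * sInf B) (1 / c j) from
    lt_min (by linarith) hbc)
  have hq3 := lt_min_iff.1 hq2
  obtain ⟨s, hs, hsq⟩ := exists_lt_of_csInf_lt ⟨r, hBr⟩ hq1
  have hq0 : (0 : ℝ) < q := by linarith
  have hqu : 1 ≤ L.u i j q := hs.2.trans (L.u_mono i j hs.1 hq0.le hsq.le)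
  have hhalf := one_le_two_mul_u_half hL hΔ h0 h1 hA hi j (hΔ ▸ ⟨hq0, q, rfl⟩) hqu
  have hlt : L.u i j (q / 2) < 1 := by
    by_contra! h
    exact notMem_of_lt_csInf (show (q : ℝ) / 2 < sInf B by linarith [hq3.1]) hBb
      ⟨by positivity, h⟩
  rw [hc j _ ⟨by positivity, hlt⟩] at hhalf
  have := (lt_div_iff₀ (hc0 j)).1 hq3.2
  linarith

lemma Valued.exists_rat_dist {L : Sig} {Δ V : Set ℝ}
    (hΔ : Δ = {x : ℝ | 0 < x ∧ ∃ q : ℚ, x = (q : ℝ)}) {A : PreStr L} (hA : Valued Δ V A)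
    (x y : A.M) : ∃ q : ℚ, A.d x y = q := by
  by_cases h : x = y
  · exact ⟨0, by rw [h, A.d_self, Rat.cast_zero]⟩
  · have h2 := hA.1 x y h
    rw [hΔ] at h2
    exact h2.2

/-- A witness `q₀` with error `ε` can be moved by little more than `ε` to reach any smaller
error. -/
lemma Realizes.exists_improve {L : Sig} (hL : L.Semiproper)
    (hlin : ∀ i, L.n i = 1 ∨ ∃ c, LinearModulus L i c) {Δ V : Set ℝ}
    (hΔ : Δ = {x : ℝ | 0 < x ∧ ∃ q : ℚ, x = (q : ℝ)})
    (hV : ∀ q : ℚ, 0 ≤ (q : ℝ) → (q : ℝ) ≤ 1 → (q : ℝ) ∈ V) (hgood : GoodPair L Δ V)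
    {A : PreStr L} (hAval : Valued Δ V A) (hA : HasUrysohnRel Δ V A)
    {U : PreStr L} {ι : A.M → U.M} (hι : Emb A U ι)
    (hdense : ∀ x : U.M, ∀ ε : ℝ, 0 < ε → ∃ y : A.M, U.d x (ι y) < ε)
    {N : PreStr L} {K : Type} [Finite K] {pt : Option K → N.M} {φ : K → U.M} {q₀ : A.M} {ε : ℝ}
    (hε : 0 < ε) (h : Realizes (U := U) pt (fun o => o.elim (ι q₀) φ) ε) {ε' : ℝ}
    (hε' : 0 < ε') :
    ∃ q, Realizes (U := U) pt (fun o => o.elim (ι q) φ) ε' ∧ U.d (ι q₀) (ι q) ≤ ε + ε' := by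
  have := L.finI
  obtain ⟨κ, hκu, hκ⟩ : ∃ κ : ℝ, (∀ i j, 3 * κ ≤ L.u i j ε') ∧ 0 < κ := by
    have : ∀ᶠ κ : ℝ in nhdsWithin 0 (Set.Ioi 0), (∀ i j, κ < L.u i j ε' / 3) ∧ 0 < κ :=
      (Filter.eventually_all.2 fun i => Filter.eventually_all.2 fun j =>
        nhdsWithin_le_nhds (gt_mem_nhds (by have := L.u_pos i j ε' hε'; positivity))).and
        self_mem_nhdsWithin
    obtain ⟨κ, h1, h2⟩ := this.exists
    exact ⟨κ, fun i j => by linarith [h1 i j], h2⟩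
  obtain ⟨η, ⟨hηu, hηc⟩, hη4, hη⟩ : ∃ η : ℝ, ((∀ i, ∑ j, L.u i j η ≤ κ) ∧
      ∀ i, L.n i = 1 ∨ ∃ c, LinearModulus L i c ∧ ∑ j, c j * (2 * η) ≤ κ) ∧
      4 * η ≤ ε' ∧ 0 < η := by
    have h4 : ∀ᶠ η : ℝ in nhdsWithin 0 (Set.Ioi 0), η < ε' / 4 :=
      nhdsWithin_le_nhds (gt_mem_nhds (by positivity))
    have h2 : ∀ i, ∀ᶠ η : ℝ in nhdsWithin 0 (Set.Ioi 0),
        L.n i = 1 ∨ ∃ c, LinearModulus L i c ∧ ∑ j, c j * (2 * η) ≤ κ := by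
      intro i
      rcases hlin i with h1 | ⟨c, hc⟩
      · exact Filter.Eventually.of_forall fun _ => Or.inl h1
      · have ht : Filter.Tendsto (fun η : ℝ => ∑ j, c j * (2 * η)) (nhds 0) (nhds 0) := by
          have : Continuous fun η : ℝ => ∑ j, c j * (2 * η) := by fun_prop
          simpa using this.tendsto 0
        filter_upwards [nhdsWithin_le_nhds (ht.eventually (gt_mem_nhds hκ))] with η h
        exact Or.inr ⟨c, hc, le_of_lt h⟩
    obtain ⟨η, h1, h2, h3, h4⟩ := ((Filter.eventually_all.2 fun i =>
      L.eventually_sum_u_lt i hκ).and ((Filter.eventually_all.2 h2).and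
        (h4.and self_mem_nhdsWithin))).exists
    exact ⟨η, ⟨fun i => (h1 i).le, h2⟩, by linarith, h4⟩
  have hηj : ∀ i j, L.u i j η ≤ κ := fun i j =>
    (Finset.single_le_sum (fun j _ => L.u_nonneg i j η) (Finset.mem_univ j)).trans (hηu i)
  choose a ha using fun k => hdense (φ k) η hη
  let b₀ : Option K → A.M := fun o => o.elim q₀ a
  let F := A.sub (Set.range b₀)
  have hFfin : Finite F.M := Set.finite_range b₀
  have hF : Valued Δ V F := A.valued_sub hAval _
  let b : Option K → F.M := fun o => ⟨b₀ o, o, rfl⟩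
  let w : Option K → ℝ := fun o => o.elim ε fun k => N.d (pt none) (pt (some k))
  have hw : ∀ o, 0 ≤ w o := by
    rintro (- | k)
    · exact hε.le
    · exact N.d_nonneg _ _
  choose g hg1 hg2 using fun o =>
    exists_rat_btwn (show w o + 2 * η < w o + 3 * η by linarith)
  have hf : ∀ y : F.M, ∃ k, ∀ l, g k + F.d (b k) y ≤ g l + F.d (b l) y := fun y =>
    Finite.exists_min fun k => (g k : ℝ) + F.d (b k) y
  choose m hm using hf
  let f : F.M → ℝ := fun y => g (m y) + F.d (b (m y)) y
  have hfΔ : ∀ y, f y ∈ Δ := by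
    intro y
    obtain ⟨q, hq⟩ := hF.exists_rat_dist hΔ (b (m y)) y
    rw [hΔ]
    refine ⟨?_, g (m y) + q, by simp only [f, hq]; push_cast; rfl⟩
    have : 0 ≤ F.d (b (m y)) y := F.d_nonneg _ _
    have := hg1 (m y)
    have := hw (m y)
    simp only [f]
    linarith
  have C : Config (F := F) pt (fun o => o.elim (ι q₀) φ) b (fun y : F.M => ι y.1)
      (fun o => (g o : ℝ)) f ε η :=
    { realizes := h
      emb := emb_of_dist (fun x y => hι.2.1 _ _) fun i x => hι.2.2 i _
      base := rfl
      near := by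
        rintro (- | k)
        · exact (U.d_self _).trans_le hη.le
        · exact (ha k).le
      ε_pos := hε
      η_pos := hη
      weight_none := (hg1 none).le
      weight_some := fun k => (hg1 (some k)).le
      f_le := fun y k => hm y k
      f_eq := fun y => ⟨m y, rfl⟩ }
  have hR : ∀ i, RelExtends F N pt b f V i κ := by
    intro i
    rcases hηc i with hn | ⟨c, hc, hcη⟩
    · exact C.relExtends_of_unary hL Δ V hgood.2.1 hV hF hn hκ (hηj i)
    · exact C.relExtends_of_linear Δ V hgood hV hF hfΔ hc hκ hcη
  choose R hRV hRu hRe hRN using hR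
  obtain ⟨q, hqd, hqR⟩ := hA.exists_point hgood.2.1 hAval (Set.range b₀) f hfΔ C.f_pos
    C.f_le_add C.dist_le_f_add_f R hRV hRu hRe
  have hfle : ∀ o, f (b o) ≤ w o + 3 * η := by
    intro o
    have h1 := hm (b o) o
    rw [F.d_self] at h1
    have := hg2 o
    simp only [f]
    linarith
  refine ⟨q, ⟨h.dist_eq, h.rel_eq, fun k => ?_, fun i v j => ?_⟩, ?_⟩
  · change |U.d (ι q) (φ k) - N.d (pt none) (pt (some k))| ≤ ε'
    have h1 : U.d (ι q) (ι (a k)) = f (b (some k)) := (hι.2.1 _ _).trans (hqd (b (some k)))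
    have h2 : f (b (some k)) ≤ N.d (pt none) (pt (some k)) + 3 * η := hfle (some k)
    have h3 := C.dist_pt_le_f k
    have h4 := U.d_triangle (ι q) (ι (a k)) (φ k)
    have h5 := U.d_triangle (ι q) (φ k) (ι (a k))
    have h6 := ha k
    have h7 := U.d_comm (φ k) (ι (a k))
    rw [abs_le]
    constructor <;> linarith
  · have h1 := U.abs_R_sub_le i (fun j => (v j).elim (ι q) φ) (fun j => ι ((v j).elim q a))
    have h2 : ∑ j, L.u i j (U.d ((v j).elim (ι q) φ) (ι ((v j).elim q a))) ≤ ∑ j, L.u i j η := by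
      refine Finset.sum_le_sum fun j _ => L.u_mono i j (U.d_nonneg _ _) hη.le ?_
      rcases v j with - | k
      · exact (U.d_self _).trans_le hη.le
      · exact (ha k).le
    have h3 : U.R i (fun j => ι ((v j).elim q a)) =
        R i fun j => (v j).map fun k => b (some k) := by
      refine (hι.2.2 i _).trans (Eq.trans ?_ (hqR i _))
      congr 1
      funext j
      rcases v j with - | k <;> rfl
    have h4 := hRN i v
    rw [← h3] at h4
    have h5 := abs_sub_le (U.R i fun j => (v j).elim (ι q) φ)
      (U.R i fun j => ι ((v j).elim q a)) (N.R i fun j => pt (v j))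
    linarith [hηu i, hκu i j]
  · have h1 : U.d (ι q) (ι q₀) = f (b none) := (hι.2.1 _ _).trans (hqd (b none))
    have h2 : f (b none) ≤ ε + 3 * η := hfle none
    rw [U.d_comm, h1]
    linarith

lemma realizes_zero_of_approx {L : Sig} {N U : PreStr L} {K : Type} {pt : Option K → N.M}
    {φ : K → U.M} {x : U.M}
    (h : ∀ δ > 0, ∃ y, U.d x y ≤ δ ∧ Realizes (U := U) pt (fun o => o.elim y φ) δ) :
    Realizes (U := U) pt (fun o => o.elim x φ) 0 := by
  obtain ⟨_, -, h1⟩ := h 1 one_pos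
  refine ⟨h1.dist_eq, h1.rel_eq, fun k => ?_, fun i w j => ?_⟩
  · refine le_of_forall_pos_le_add fun δ hδ => ?_
    obtain ⟨y, hxy, hy⟩ := h (δ / 2) (by positivity)
    have h2 := abs_le.1 (hy.dist_near k)
    change |U.d x (φ k) - N.d (pt none) (pt (some k))| ≤ _
    change _ ≤ U.d y (φ k) - _ ∧ U.d y (φ k) - _ ≤ _ at h2
    have h4 := U.d_triangle x y (φ k)
    have h5 := U.d_triangle y x (φ k)
    have h6 := U.d_comm x y
    rw [abs_le]
    constructor <;> linarith [h2.1, h2.2]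
  · rw [L.u_zero]
    refine le_of_forall_pos_le_add fun δ hδ => ?_
    obtain ⟨η, ⟨h2, h3⟩, hη⟩ := (((L.eventually_sum_u_lt i (half_pos hδ)).and
      (L.eventually_u_lt i j (half_pos hδ))).and self_mem_nhdsWithin).exists
    obtain ⟨y, hxy, hy⟩ := h η hη
    have h4 := U.abs_R_sub_le i (fun j => (w j).elim x φ) (fun j => (w j).elim y φ)
    have h5 : ∑ j, L.u i j (U.d ((w j).elim x φ) ((w j).elim y φ)) ≤ ∑ j, L.u i j η := by
      refine Finset.sum_le_sum fun j _ => L.u_mono i j (U.d_nonneg _ _) (le_of_lt hη) ?_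
      rcases w j with - | k
      · exact hxy
      · exact (U.d_self _).trans_le (le_of_lt hη)
    have h6 := hy.rel_near i w j
    have h7 := abs_sub_le (U.R i fun j => (w j).elim x φ)
      (U.R i fun j => (w j).elim y φ) (N.R i fun j => pt (w j))
    linarith

/-- A sequence of successively better witnesses converges to an exact one. -/
lemma PreStr.IsComplete.exists_realizes {L : Sig} {N U : PreStr L} (hU : U.IsComplete)
    {K : Type} {pt : Option K → N.M} {φ : K → U.M} {X : Type} {ι : X → U.M}
    (himp : ∀ q₀ ε ε', 0 < ε → 0 < ε' → Realizes (U := U) pt (fun o => o.elim (ι q₀) φ) ε →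
      ∃ q, Realizes (U := U) pt (fun o => o.elim (ι q) φ) ε' ∧ U.d (ι q₀) (ι q) ≤ ε + ε')
    {q₀ : X} {ε : ℝ} (hε : 0 < ε) (h : Realizes (U := U) pt (fun o => o.elim (ι q₀) φ) ε) :
    ∃ x, Realizes (U := U) pt (fun o => o.elim x φ) 0 := by
  have hpos : ∀ n : ℕ, 0 < ε / 2 ^ n := fun n => by positivity
  choose! next hnext hdist using himp
  let q : ℕ → X := fun n => n.rec q₀ fun n q => next q (ε / 2 ^ n) (ε / 2 ^ (n + 1))
  have hq : ∀ n, Realizes (U := U) pt (fun o => o.elim (ι (q n)) φ) (ε / 2 ^ n) := by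
    intro n
    induction n with
    | zero => rwa [pow_zero, div_one]
    | succ n ih => exact hnext _ _ _ (hpos n) (hpos _) ih
  have hd : ∀ n, U.d (ι (q n)) (ι (q (n + 1))) ≤ ε / 2 ^ n + ε / 2 ^ (n + 1) :=
    fun n => hdist _ _ _ (hpos n) (hpos _) (hq n)
  have hdk : ∀ n k, U.d (ι (q n)) (ι (q (n + k))) ≤ 3 * (ε / 2 ^ n) - 3 * (ε / 2 ^ (n + k)) := by
    intro n k
    induction k with
    | zero => simp [U.d_self]
    | succ k ih =>
      have h1 := U.d_triangle (ι (q n)) (ι (q (n + k))) (ι (q (n + k + 1)))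
      have h2 := hd (n + k)
      have h3 : ε / 2 ^ (n + k) = 2 * (ε / 2 ^ (n + k + 1)) := by
        rw [pow_succ]; field_simp
      rw [← add_assoc]
      linarith
  have hdle : ∀ n m, n ≤ m → U.d (ι (q n)) (ι (q m)) ≤ 3 * (ε / 2 ^ n) := by
    intro n m hnm
    obtain ⟨k, rfl⟩ := Nat.exists_eq_add_of_le hnm
    linarith [hdk n k, hpos (n + k)]
  have hsmall : ∀ δ > 0, ∃ n₀ : ℕ, ∀ n ≥ n₀, ε / 2 ^ n < δ := by
    intro δ hδ
    have : Filter.Tendsto (fun n : ℕ => ε / 2 ^ n) Filter.atTop (nhds 0) := by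
      simpa [div_eq_mul_inv] using
        (tendsto_pow_atTop_nhds_zero_of_lt_one (by norm_num)
          (by norm_num : (2 : ℝ)⁻¹ < 1)).const_mul ε
    exact Filter.eventually_atTop.1 (this.eventually (gt_mem_nhds hδ))
  obtain ⟨x, hx⟩ := hU (fun n => ι (q n)) fun δ hδ => by
    obtain ⟨n₀, hn₀⟩ := hsmall (δ / 6) (by positivity)
    refine ⟨n₀, fun m hm n hn => ?_⟩
    have h1 := hdle n₀ m hm
    have h2 := hdle n₀ n hn
    have h3 := U.d_triangle (ι (q m)) (ι (q n₀)) (ι (q n))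
    have h4 := U.d_comm (ι (q m)) (ι (q n₀))
    have h5 := hn₀ n₀ le_rfl
    linarith
  refine ⟨x, realizes_zero_of_approx fun δ hδ => ?_⟩
  obtain ⟨n₀, hn₀⟩ := hsmall δ hδ
  obtain ⟨n₁, hn₁⟩ := hx δ hδ
  have hr := hq (max n₀ n₁)
  have hs := hn₀ (max n₀ n₁) (le_max_left _ _)
  refine ⟨ι (q (max n₀ n₁)), ?_, hr.dist_eq, hr.rel_eq, fun k => (hr.dist_near k).trans hs.le,
    fun i w j => (hr.rel_near i w j).trans (L.u_mono i j (hpos _).le hδ.le hs.le)⟩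
  rw [U.d_comm]
  exact (hn₁ _ (le_max_right _ _)).le

/-- Every point realizes `pt` up to some error. -/
lemma Sig.Semiproper.exists_realizes {L : Sig} (hL : L.Semiproper) {N U : PreStr L} {K : Type}
    [Finite K] {pt : Option K → N.M} {φ : K → U.M}
    (hd : ∀ k l, N.d (pt (some k)) (pt (some l)) = U.d (φ k) (φ l))
    (hR : ∀ i (w : Fin (L.n i) → K),
      N.R i (fun j => pt (some (w j))) = U.R i fun j => φ (w j)) (x : U.M) :
    ∃ ε, 0 < ε ∧ Realizes (U := U) pt (fun o => o.elim x φ) ε := by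
  have := L.finI
  obtain ⟨ε, h1, h2, h3⟩ := ((Filter.eventually_all.2 fun k => Filter.eventually_ge_atTop
      |U.d x (φ k) - N.d (pt none) (pt (some k))|).and
    ((Filter.eventually_all.2 fun i => Filter.eventually_all.2 fun j =>
      hL.eventually_one_le i j).and (Filter.eventually_gt_atTop 0))).exists
  exact ⟨ε, h3, hd, hR, h1, fun i w j =>
    (abs_sub_le_one (U.R_mem i _) (N.R_mem i _)).trans (h2 i j)⟩

/-- An exact realization of the new point extends the embedding. -/
lemma Realizes.exists_extension {L : Sig} {M N U : PreStr L} {e : M.M → N.M} {φ : M.M → U.M}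
    {p : N.M} (hp : p ∉ Set.range e) (hN : ∀ y, y ∈ Set.range e ∨ y = p) {x : U.M}
    (he : Function.Injective e)
    (h : Realizes (U := U) (fun o : Option M.M => o.elim p e) (fun o => o.elim x φ) 0) :
    ∃ ψ : N.M → U.M, Emb N U ψ ∧ ψ ∘ e = φ := by
  let pt : Option M.M → N.M := fun o => o.elim p e
  let y : Option M.M → U.M := fun o => o.elim x φ
  have hsurj : ∀ z, ∃ o, pt o = z := by
    intro z
    rcases hN z with ⟨k, rfl⟩ | rfl
    · exact ⟨some k, rfl⟩
    · exact ⟨none, rfl⟩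
  choose s hs using hsurj
  have hd : ∀ o o', U.d (y o) (y o') = N.d (pt o) (pt o') := by
    have hn : ∀ k, U.d (y none) (y (some k)) = N.d (pt none) (pt (some k)) := fun k =>
      sub_eq_zero.1 (abs_nonpos_iff.1 (h.dist_near k))
    rintro (- | k) (- | l)
    · rw [U.d_self, N.d_self]
    · exact hn l
    · rw [U.d_comm, N.d_comm, hn]
    · exact (h.dist_eq k l).symm
  have hR : ∀ i (w : Fin (L.n i) → Option M.M),
      U.R i (fun j => y (w j)) = N.R i fun j => pt (w j) := fun i w => by
    have := h.rel_near i w ⟨0, L.n_pos i⟩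
    rw [L.u_zero] at this
    exact sub_eq_zero.1 (abs_nonpos_iff.1 this)
  refine ⟨fun z => y (s z), emb_of_dist (fun z z' => ?_) (fun i z => ?_), funext fun k => ?_⟩
  · rw [hd, hs, hs]
  · refine (hR i fun j => s (z j)).trans ?_
    simp only [hs]
  · have hk : s (e k) = some k := by
      have := hs (e k)
      rcases hsk : s (e k) with - | l
      · rw [hsk] at this
        exact absurd ⟨k, this.symm⟩ hp
      · rw [hsk] at this
        exact congrArg some (he this)
    simp only [Function.comp, hk]
    rfl

/-- Theorem (paper Thm 5.5): let `L` be proper, `Δ = ℚ ∩ (0, ∞)`, and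
`V ⊇ ℚ ∩ [0,1]` with `(Δ, V)` a good value pair for `L`.  If `A` is a countable
`(Δ, V)`-valued continuous `L`-pre-structure with the rational Urysohn
property, then any continuous `L`-structure containing `A` as a dense
substructure (i.e. any completion of `A`) has the Urysohn property. -/
theorem stmt13 (L : Sig) (hL : L.Proper) (Δ V : Set ℝ)
    (hΔ : Δ = {x : ℝ | 0 < x ∧ ∃ q : ℚ, x = (q : ℝ)})
    (hV : ∀ q : ℚ, 0 ≤ (q : ℝ) → (q : ℝ) ≤ 1 → (q : ℝ) ∈ V)
    (hgood : GoodPair L Δ V)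
    (A : PreStr L) (hAcnt : Countable A.M) (hAval : Valued Δ V A)
    (hA : HasUrysohnRel Δ V A)
    (Abar : PreStr L) (ι : A.M → Abar.M) (hι : Emb A Abar ι)
    (hdense : ∀ x : Abar.M, ∀ ε : ℝ, 0 < ε → ∃ y : A.M, Abar.d x (ι y) < ε)
    (hcomp : Abar.IsComplete) :
    HasUrysohn Abar := by
  have hL' := hL.1
  have h0 : (0 : ℝ) ∈ V := by simpa using hV 0 (by simp) (by simp)
  have h1 : (1 : ℝ) ∈ V := by simpa using hV 1 (by simp) (by simp)
  have hlin : ∀ i, L.n i = 1 ∨ ∃ c, LinearModulus L i c := by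
    intro i
    rcases (L.n_pos i).eq_or_lt with h | h
    · exact Or.inl h.symm
    · exact Or.inr (exists_linearModulus hL' hΔ h0 h1 hA h)
  have hone : (1 : ℝ) ∈ Δ := by
    rw [hΔ]
    exact ⟨one_pos, 1, by simp⟩
  obtain ⟨χ, -⟩ := hA.exists_emb
    (triangle L 1 1 one_pos one_pos (by norm_num) (fun _ => ∅) (by simp))
    (valued_triangle hone hone h0 h1)
  intro M N e hM hN φ hφ
  obtain ⟨he, p, hp, hcover⟩ := hN
  obtain ⟨ε, hε, h⟩ := hL'.exists_realizes (pt := fun o : Option M.M => o.elim p e) (φ := φ)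
    (fun k l => (he.2.1 k l).trans (hφ.2.1 k l).symm)
    (fun i w => (he.2.2 i w).trans (hφ.2.2 i w).symm) (ι (χ (0 : Fin 3)))
  obtain ⟨x, hx⟩ := hcomp.exists_realizes (fun _ _ _ hε hε' h =>
    h.exists_improve hL' hlin hΔ hV hgood hAval hA hι hdense hε hε') hε h
  exact hx.exists_extension hp hcover he.1

end ContLogic
end

section
/- Let L be a proper continuous signature, let Δ = ℚ ∩ (0, ∞), and let V ⊆ [0,1] with ℚ ∩ [0,1] ⊆ V be such that (Δ, V) is a good value pair for L. Let M be a countable (Δ,V)-valued continuous L-pre-structure with the rational Urysohn property, and let M̄ be a continuous L-structure containing M as a dense substructure. Then the automorphisms of M̄ that map M onto itself are dense in the automorphism group of M̄ in the topology of pointwise convergence: for every automorphism g of M̄, all x_1, …, x_n ∈ M̄, and every ε > 0, there is an automorphism h of M̄ with h(M) = M and d(g(x_i), h(x_i)) < ε for all 1 ≤ i ≤ n. -/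
namespace ContLogic

section Auxiliary

variable {L : Sig} {Δ V : Set ℝ} {A B N : PreStr L}

namespace PreStr

theorem d_nonneg_s14 (A : PreStr L) (x y : A.M) : 0 ≤ A.d x y := by
  have h := A.d_triangle x y x
  rw [A.d_self, A.d_comm y x] at h
  linarith

theorem abs_R_sub_le_one (A : PreStr L) (i : L.I) (x y : Fin (L.n i) → A.M) :
    |A.R i x - A.R i y| ≤ 1 := by
  have hx := A.R_mem i x
  have hy := A.R_mem i y
  rw [abs_le]
  constructor <;> linarith [hx.1, hx.2, hy.1, hy.2]

/-- The metric space underlying a continuous pre-structure. -/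
@[reducible] def metricSpace (A : PreStr L) : MetricSpace A.M where
  dist := A.d
  dist_self := A.d_self
  dist_comm := A.d_comm
  dist_triangle := A.d_triangle
  eq_of_dist_eq_zero := A.d_eq_zero _ _

/-- The substructure of `A` with universe `S`. -/
@[reducible] def restrict (A : PreStr L) (S : Set A.M) : PreStr L where
  M := S
  d x y := A.d x y
  d_self x := A.d_self x
  d_eq_zero x y h := Subtype.ext (A.d_eq_zero x y h)
  d_comm x y := A.d_comm x y
  d_triangle x y z := A.d_triangle x y z
  R i w := A.R i fun k => (w k : A.M)
  R_mem i _ := A.R_mem i _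
  R_uc i j _ _ h := A.R_uc i j _ _ fun k hk => congrArg Subtype.val (h k hk)

end PreStr

theorem Valued.restrict (hA : Valued Δ V A) (S : Set A.M) : Valued Δ V (A.restrict S) :=
  ⟨fun x y hxy => hA.1 x.1 y.1 fun h => hxy (Subtype.ext h), fun i _ => hA.2 i _⟩

/-- The set of pairs `s` is (the graph of) an isomorphism between substructures of `A` and `B`. -/
def IsPartialIso (A B : PreStr L) (s : Set (A.M × B.M)) : Prop :=
  (∀ p ∈ s, ∀ q ∈ s, B.d p.2 q.2 = A.d p.1 q.1) ∧
  ∀ (i : L.I) (w : Fin (L.n i) → A.M × B.M), (∀ k, w k ∈ s) →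
    B.R i (fun k => (w k).2) = A.R i (fun k => (w k).1)

namespace IsPartialIso

theorem eq_of_fst_eq {s : Set (A.M × B.M)} (h : IsPartialIso A B s) {p q : A.M × B.M}
    (hp : p ∈ s) (hq : q ∈ s) (hpq : p.1 = q.1) : p.2 = q.2 :=
  B.d_eq_zero _ _ (by rw [h.1 p hp q hq, hpq, A.d_self])

theorem swap {s : Set (A.M × B.M)} (h : IsPartialIso A B s) :
    IsPartialIso B A (Prod.swap ⁻¹' s) :=
  ⟨fun _ hp _ hq => (h.1 _ hp _ hq).symm, fun i w hw => (h.2 i (fun k => (w k).swap) hw).symm⟩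

theorem empty : IsPartialIso A B ∅ :=
  ⟨fun _ hp => hp.elim, fun i _ hw => (hw ⟨0, L.n_pos i⟩).elim⟩

theorem mono {s t : Set (A.M × B.M)} (h : IsPartialIso A B t) (hst : s ⊆ t) :
    IsPartialIso A B s :=
  ⟨fun p hp q hq => h.1 p (hst hp) q (hst hq), fun i w hw => h.2 i w fun k => hst (hw k)⟩

theorem exists_insert (hA : HasUrysohnRel Δ V A) (hN : Valued Δ V N) {s : Set (N.M × A.M)}
    (hs : s.Finite) (h : IsPartialIso N A s) (p : N.M) :
    ∃ b, IsPartialIso N A (insert (p, b) s) := by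
  classical
  by_cases hp : ∃ b, (p, b) ∈ s
  · obtain ⟨b, hb⟩ := hp
    exact ⟨b, by rwa [Set.insert_eq_of_mem hb]⟩
  set S : Set N.M := Prod.fst '' s
  have hφ : ∀ x : S, ∃ b, ((x : N.M), b) ∈ s := by
    rintro ⟨x, ⟨x', b⟩, hb, rfl⟩
    exact ⟨b, hb⟩
  choose φ hφ using hφ
  have hpS : p ∉ S := by
    rintro ⟨⟨x, b⟩, hb, rfl⟩
    exact hp ⟨b, hb⟩
  have hsub : S ⊆ insert p S := Set.subset_insert _ _
  have hφd : ∀ x y : S, A.d (φ x) (φ y) = N.d x y := fun x y => h.1 _ (hφ x) _ (hφ y)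
  have hfin : Finite S := (hs.image _).to_subtype
  obtain ⟨ψ, hψ, hψφ⟩ := hA (N.restrict S) (N.restrict (insert p S)) (Set.inclusion hsub) hfin
    (hN.restrict _) (hN.restrict _)
    ⟨⟨Set.inclusion_injective hsub, fun _ _ => rfl, fun _ _ => rfl⟩,
      ⟨p, Set.mem_insert _ _⟩, by
        rintro ⟨x, hx⟩
        have hx' : (x : N.M) = p := congrArg Subtype.val hx
        exact hpS (hx' ▸ x.2), by
        rintro ⟨y, rfl | hy⟩
        · exact Or.inr rfl
        · exact Or.inl ⟨⟨y, hy⟩, rfl⟩⟩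
    φ ⟨fun x y hxy => Subtype.ext (N.d_eq_zero _ _ (by rw [← hφd x y, hxy, A.d_self])), hφd,
      fun i x => h.2 i (fun k => ((x k).1, φ (x k))) fun k => hφ (x k)⟩
  refine ⟨ψ ⟨p, Set.mem_insert _ _⟩, ?_⟩
  have key : ∀ q ∈ insert (p, ψ ⟨p, Set.mem_insert _ _⟩) s,
      ∃ ht : q.1 ∈ insert p S, ψ ⟨q.1, ht⟩ = q.2 := by
    rintro q (rfl | hq)
    · exact ⟨Set.mem_insert _ _, rfl⟩
    · have hqS : q.1 ∈ S := ⟨q, hq, rfl⟩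
      refine ⟨hsub hqS, ?_⟩
      have h1 : ψ ⟨q.1, hsub hqS⟩ = φ ⟨q.1, hqS⟩ := congrFun hψφ ⟨q.1, hqS⟩
      rw [h1]
      exact h.eq_of_fst_eq (hφ ⟨q.1, hqS⟩) hq rfl
  refine ⟨fun q hq q' hq' => ?_, fun i w hw => ?_⟩
  · obtain ⟨h1, e1⟩ := key q hq
    obtain ⟨h2, e2⟩ := key q' hq'
    rw [← e1, ← e2]
    exact hψ.2.1 ⟨q.1, h1⟩ ⟨q'.1, h2⟩
  · choose h1 e1 using fun k => key _ (hw k)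
    have := hψ.2.2 i fun k => ⟨(w k).1, h1 k⟩
    rw [show (fun k => (w k).2) = ψ ∘ fun k => ⟨(w k).1, h1 k⟩ from funext fun k => (e1 k).symm]
    exact this

theorem exists_extend_finite (hA : HasUrysohnRel Δ V A) (hN : Valued Δ V N)
    {s : Set (N.M × A.M)} (hs : s.Finite) (h : IsPartialIso N A s) {T : Set N.M} (hT : T.Finite) :
    ∃ t, s ⊆ t ∧ t.Finite ∧ IsPartialIso N A t ∧ ∀ p ∈ T, ∃ b, (p, b) ∈ t := by
  induction T, hT using Set.Finite.induction_on with
  | empty => exact ⟨s, subset_rfl, hs, h, by simp⟩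
  | @insert p T _ _ ih =>
    obtain ⟨t, hst, htf, ht, hT'⟩ := ih
    obtain ⟨b, hb⟩ := exists_insert hA hN htf ht p
    refine ⟨insert (p, b) t, hst.trans (Set.subset_insert _ _), htf.insert _, hb, ?_⟩
    rintro q (rfl | hq)
    · exact ⟨b, Set.mem_insert _ _⟩
    · obtain ⟨b', hb'⟩ := hT' q hq
      exact ⟨b', Set.mem_insert_of_mem _ hb'⟩

/-- Back and forth: a finite partial isomorphism of a countable structure with the relative
Urysohn property extends to an automorphism. -/
theorem exists_equiv [Countable A.M] (hA : HasUrysohnRel Δ V A) (hAv : Valued Δ V A)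
    {s : Set (A.M × A.M)} (hs : s.Finite) (h : IsPartialIso A A s) :
    ∃ σ : A.M ≃ A.M, (∀ x y, A.d (σ x) (σ y) = A.d x y) ∧
      (∀ i (w : Fin (L.n i) → A.M), A.R i (σ ∘ w) = A.R i w) ∧ ∀ p ∈ s, σ p.1 = p.2 := by
  classical
  let P := {t : Set (A.M × A.M) // t.Finite ∧ IsPartialIso A A t}
  let D : A.M ⊕ A.M → Order.Cofinal P := fun x => match x with
    | .inl a => ⟨{t | ∃ b, (a, b) ∈ t.1}, fun t => by
        obtain ⟨b, hb⟩ := exists_insert hA hAv t.2.1 t.2.2 a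
        exact ⟨⟨insert (a, b) t.1, t.2.1.insert _, hb⟩, ⟨b, Set.mem_insert _ _⟩,
          Set.subset_insert _ _⟩⟩
    | .inr b => ⟨{t | ∃ a, (a, b) ∈ t.1}, fun t => by
        obtain ⟨a, ha⟩ := exists_insert hA hAv
          (t.2.1.preimage Prod.swap_injective.injOn) t.2.2.swap b
        refine ⟨⟨insert (a, b) t.1, t.2.1.insert _, ?_⟩, ⟨a, Set.mem_insert _ _⟩,
          Set.subset_insert _ _⟩
        refine ha.swap.mono ?_
        rintro q (rfl | hq)
        · exact Set.mem_insert _ _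
        · exact Set.mem_insert_of_mem _ hq⟩
  have : Encodable (A.M ⊕ A.M) := Encodable.ofCountable _
  let seq := Order.sequenceOfCofinals (⟨s, hs, h⟩ : P) D
  have hmono : Monotone seq := Order.sequenceOfCofinals.monotone _ _
  set U : Set (A.M × A.M) := ⋃ n, (seq n).1
  have hmem : ∀ n, (seq n).1 ⊆ U := fun n => Set.subset_iUnion (fun n => (seq n).1) n
  have hUiso : IsPartialIso A A U := by
    refine ⟨fun p hp q hq => ?_, fun i w hw => ?_⟩
    · obtain ⟨n, hn⟩ := Set.mem_iUnion.1 hp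
      obtain ⟨m, hm⟩ := Set.mem_iUnion.1 hq
      exact (seq (max n m)).2.2.1 p (hmono (le_max_left n m) hn) q (hmono (le_max_right n m) hm)
    · choose n hn using fun k => Set.mem_iUnion.1 (hw k)
      exact (seq (Finset.univ.sup n)).2.2.2 i w fun k =>
        hmono (Finset.le_sup (Finset.mem_univ k)) (hn k)
  have hforth : ∀ a, ∃ b, (a, b) ∈ U := fun a => by
    obtain ⟨b, hb⟩ := Order.sequenceOfCofinals.encode_mem (⟨s, hs, h⟩ : P) D (.inl a)
    exact ⟨b, hmem _ hb⟩
  have hback : ∀ b, ∃ a, (a, b) ∈ U := fun b => by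
    obtain ⟨a, ha⟩ := Order.sequenceOfCofinals.encode_mem (⟨s, hs, h⟩ : P) D (.inr b)
    exact ⟨a, hmem _ ha⟩
  choose f hf using hforth
  choose g hg using hback
  refine ⟨⟨f, g, fun a => ?_, fun b => ?_⟩, fun x y => hUiso.1 _ (hf x) _ (hf y),
    fun i w => hUiso.2 i (fun k => (w k, f (w k))) fun k => hf (w k), fun p hp => ?_⟩
  · exact hUiso.swap.eq_of_fst_eq (p := (f a, g (f a))) (q := (f a, a)) (hg (f a)) (hf a) rfl
  · exact hUiso.eq_of_fst_eq (hf (g b)) (hg b) rfl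
  · exact hUiso.eq_of_fst_eq (hf p.1) (hmem 0 hp) rfl

end IsPartialIso

theorem abs_sub_le_sum_of_single_coordinate {X : Type*} {n : ℕ} (f : (Fin n → X) → ℝ)
    (b : Fin n → X → X → ℝ)
    (h : ∀ j x y, (∀ k, k ≠ j → x k = y k) → |f x - f y| ≤ b j (x j) (y j)) (x y : Fin n → X) :
    |f x - f y| ≤ ∑ j, b j (x j) (y j) := by
  classical
  suffices H : ∀ F : Finset (Fin n), |f x - f (F.piecewise y x)| ≤ ∑ j ∈ F, b j (x j) (y j) by
    simpa using H Finset.univ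
  intro F
  induction F using Finset.induction_on with
  | empty => simp
  | insert j F hj ih =>
    rw [Finset.sum_insert hj]
    have h1 := h j (F.piecewise y x) ((insert j F).piecewise y x) fun k hk => by
      simp [Finset.piecewise, hk]
    rw [Finset.piecewise_eq_of_notMem _ _ _ hj,
      Finset.piecewise_eq_of_mem _ _ _ (Finset.mem_insert_self j F)] at h1
    have h2 := abs_sub_le (f x) (f (F.piecewise y x)) (f ((insert j F).piecewise y x))
    linarith

theorem PreStr.exists_forall_abs_R_sub_lt (A : PreStr L) (i : L.I) {η : ℝ} (hη : 0 < η) :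
    ∃ δ : ℝ, 0 < δ ∧ ∀ x y : Fin (L.n i) → A.M, (∀ k, A.d (x k) (y k) ≤ δ) →
      |A.R i x - A.R i y| < η := by
  have ht : Filter.Tendsto (fun t => ∑ j, L.u i j t) (nhdsWithin 0 (Set.Ioi 0)) (nhds 0) := by
    simpa using tendsto_finsetSum Finset.univ fun j _ => L.u_lim i j
  obtain ⟨δ, hδη, hδ⟩ := ((ht.eventually (gt_mem_nhds hη)).and self_mem_nhdsWithin).exists
  have hδ : 0 < δ := hδ
  refine ⟨δ, hδ, fun x y hxy => ?_⟩
  calc |A.R i x - A.R i y| ≤ ∑ j, L.u i j (A.d (x j) (y j)) :=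
        abs_sub_le_sum_of_single_coordinate _ (fun j p q => L.u i j (A.d p q)) (A.R_uc i) x y
    _ ≤ ∑ j, L.u i j δ := Finset.sum_le_sum fun j _ =>
        L.u_mono i j (A.d_nonneg_s14 _ _) hδ.le (hxy j)
    _ < η := hδη

theorem PreStr.abs_d_sub_d_le (A : PreStr L) (x x' y y' : A.M) :
    |A.d x x' - A.d y y'| ≤ A.d x y + A.d x' y' := by
  let := A.metricSpace
  exact dist_dist_dist_le x x' y y'

/-- The pair `(x, y)` is a limit of pairs `(ι a, ι (σ a))`. -/
def IsLimitPair (ι : A.M → B.M) (σ : A.M → A.M) (x y : B.M) : Prop :=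
  ∀ ε : ℝ, 0 < ε → ∃ a, B.d x (ι a) < ε ∧ B.d y (ι (σ a)) < ε

theorem isLimitPair_apply (ι : A.M → B.M) (σ : A.M → A.M) (a : A.M) :
    IsLimitPair ι σ (ι a) (ι (σ a)) := fun ε hε => ⟨a, by simpa [B.d_self], by simpa [B.d_self]⟩

theorem IsLimitPair.symm {ι : A.M → B.M} {σ : A.M ≃ A.M} {x y : B.M}
    (h : IsLimitPair ι σ x y) : IsLimitPair ι σ.symm y x := fun ε hε => by
  obtain ⟨a, h1, h2⟩ := h ε hε
  exact ⟨σ a, h2, by simpa using h1⟩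

theorem IsLimitPair.d_eq {ι : A.M → B.M} (hι : Emb A B ι) {σ : A.M → A.M}
    (hσ : ∀ x y, A.d (σ x) (σ y) = A.d x y) {x y x' y' : B.M}
    (h : IsLimitPair ι σ x y) (h' : IsLimitPair ι σ x' y') : B.d y y' = B.d x x' := by
  refine eq_of_abs_sub_le_all fun ε hε => ?_
  obtain ⟨a, h1, h2⟩ := h (ε / 4) (by positivity)
  obtain ⟨a', h1', h2'⟩ := h' (ε / 4) (by positivity)
  have e1 := B.abs_d_sub_d_le x x' (ι a) (ι a')
  have e2 := B.abs_d_sub_d_le y y' (ι (σ a)) (ι (σ a'))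
  rw [hι.2.1, hσ] at e2
  rw [hι.2.1] at e1
  rw [abs_le] at *
  constructor <;> linarith

theorem IsLimitPair.R_eq {ι : A.M → B.M} (hι : Emb A B ι) {σ : A.M → A.M}
    (hσ : ∀ i (w : Fin (L.n i) → A.M), A.R i (σ ∘ w) = A.R i w) (i : L.I)
    {x y : Fin (L.n i) → B.M} (h : ∀ k, IsLimitPair ι σ (x k) (y k)) : B.R i y = B.R i x := by
  refine eq_of_abs_sub_le_all fun ε hε => ?_
  obtain ⟨δ, hδ, H⟩ := B.exists_forall_abs_R_sub_lt i (half_pos hε)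
  choose a h1 h2 using fun k => h k δ hδ
  have e1 := H x (ι ∘ a) fun k => (h1 k).le
  have e2 := H y (ι ∘ (σ ∘ a)) fun k => (h2 k).le
  rw [hι.2.2, hσ] at e2
  rw [hι.2.2] at e1
  rw [abs_lt] at e1 e2
  rw [abs_le]
  constructor <;> linarith

theorem exists_isLimitPair {ι : A.M → B.M} (hι : Emb A B ι) {σ : A.M → A.M}
    (hσ : ∀ x y, A.d (σ x) (σ y) = A.d x y) (hcomp : B.IsComplete)
    (hdense : ∀ x : B.M, ∀ ε : ℝ, 0 < ε → ∃ y : A.M, B.d x (ι y) < ε) (x : B.M) :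
    ∃ y, IsLimitPair ι σ x y := by
  choose a ha using fun n : ℕ => hdense x (1 / ((n : ℝ) + 1)) Nat.one_div_pos_of_nat
  have hsmall : ∀ ε : ℝ, 0 < ε → ∃ N : ℕ, ∀ n ≥ N, B.d x (ι (a n)) < ε := fun ε hε => by
    obtain ⟨N, hN⟩ := exists_nat_one_div_lt hε
    exact ⟨N, fun n hn => (ha n).trans ((Nat.one_div_le_one_div hn).trans_lt hN)⟩
  obtain ⟨y, hy⟩ := hcomp (fun n => ι (σ (a n))) fun ε hε => by
    obtain ⟨N, hN⟩ := hsmall (ε / 2) (by positivity)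
    refine ⟨N, fun m hm n hn => ?_⟩
    rw [hι.2.1, hσ, ← hι.2.1]
    have := B.d_triangle (ι (a m)) x (ι (a n))
    rw [B.d_comm (ι (a m)) x] at this
    linarith [hN m hm, hN n hn]
  refine ⟨y, fun ε hε => ?_⟩
  obtain ⟨N, hN⟩ := hsmall ε hε
  obtain ⟨M, hM⟩ := hy ε hε
  exact ⟨a (max N M), hN _ (le_max_left _ _), by
    rw [B.d_comm]; exact hM _ (le_max_right _ _)⟩

/-- An automorphism of a dense substructure extends to the complete structure. -/
theorem exists_aut_extension {ι : A.M → B.M} (hι : Emb A B ι) (hcomp : B.IsComplete)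
    (hdense : ∀ x : B.M, ∀ ε : ℝ, 0 < ε → ∃ y : A.M, B.d x (ι y) < ε) (σ : A.M ≃ A.M)
    (hσd : ∀ x y, A.d (σ x) (σ y) = A.d x y)
    (hσR : ∀ i (w : Fin (L.n i) → A.M), A.R i (σ ∘ w) = A.R i w) :
    ∃ h : B.M → B.M, Aut B h ∧ ∀ a, h (ι a) = ι (σ a) := by
  choose h hh using exists_isLimitPair hι hσd hcomp hdense
  have hσd' : ∀ x y, A.d (σ.symm x) (σ.symm y) = A.d x y := fun x y => by
    rw [← hσd, σ.apply_symm_apply, σ.apply_symm_apply]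
  have hd : ∀ x y, B.d (h x) (h y) = B.d x y := fun x y => (hh x).d_eq hι hσd (hh y)
  have huniq : ∀ {x y}, IsLimitPair ι σ x y → h x = y := fun {x y} hxy =>
    B.d_eq_zero _ _ (by rw [(hh x).d_eq hι hσd hxy, B.d_self])
  have hinj : Function.Injective h := fun x y hxy =>
    B.d_eq_zero _ _ (by rw [← hd, hxy, B.d_self])
  refine ⟨h, ⟨⟨hinj, fun y => ?_⟩, hinj, hd, fun i x =>
    IsLimitPair.R_eq hι hσR i fun k => hh (x k)⟩, fun a => huniq (isLimitPair_apply ι σ a)⟩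
  obtain ⟨x, hx⟩ := exists_isLimitPair hι hσd' hcomp hdense y
  exact ⟨x, huniq (by simpa using hx.symm)⟩

/-- The continuous pre-structure on three points, of which `0` and `1` are at distance `a` and
all other pairs are at distance `b`. -/
@[reducible] noncomputable def isosceles {a b : ℝ} (ha : 0 < a) (hb : 0 < b) (hab : a ≤ 2 * b)
    (R : (i : L.I) → (Fin (L.n i) → Fin 3) → ℝ) (hR : ∀ i x, R i x ∈ Set.Icc (0 : ℝ) 1)
    (huc : ∀ (i : L.I) (j : Fin (L.n i)) (x y : Fin (L.n i) → Fin 3),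
      (∀ k, k ≠ j → x k = y k) → x j ≠ y j →
      |R i x - R i y| ≤ L.u i j (if x j = 2 ∨ y j = 2 then b else a)) : PreStr L where
  M := Fin 3
  d x y := if x = y then 0 else if x = 2 ∨ y = 2 then b else a
  d_self x := by simp
  d_eq_zero x y h := by
    by_contra hne
    rw [if_neg hne] at h
    split_ifs at h <;> linarith
  d_comm x y := by simp only [eq_comm, or_comm]
  d_triangle x y z := by
    fin_cases x <;> fin_cases y <;> fin_cases z <;> simp <;> linarith
  R := R
  R_mem := hR
  R_uc i j x y h := by
    by_cases hj : x j = y j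
    · have : x = y := funext fun k => by
        by_cases hk : k = j
        · rw [hk, hj]
        · exact h k hk
      rw [this]
      simp [L.u_nonneg]
    · rw [if_neg hj]
      exact huc i j x y h hj

theorem valued_isosceles {a b : ℝ} {ha : 0 < a} {hb : 0 < b} {hab : a ≤ 2 * b}
    {R : (i : L.I) → (Fin (L.n i) → Fin 3) → ℝ} {hR huc} (haΔ : a ∈ Δ) (hbΔ : b ∈ Δ)
    (hRV : ∀ i x, R i x ∈ V) : Valued Δ V (isosceles (L := L) ha hb hab R hR huc) := by
  refine ⟨fun x y hxy => ?_, hRV⟩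
  change (if x = y then 0 else if x = 2 ∨ y = 2 then b else a) ∈ Δ
  rw [if_neg hxy]
  split_ifs <;> assumption

theorem lt_one_of_mul_lt_one_of_hasUrysohnRel (hbdd : ∀ i j, BddAbove (L.Ival i j))
    (hΔ : Δ = {x : ℝ | 0 < x ∧ ∃ q : ℚ, x = (q : ℝ)}) (h0 : (0 : ℝ) ∈ V) (h1 : (1 : ℝ) ∈ V)
    (hA : HasUrysohnRel Δ V A) {i : L.I} (hn : 2 ≤ L.n i) (j : Fin (L.n i)) {K : ℝ} (hK : 0 < K)
    (hKu : ∀ r ∈ L.Ival i j, L.u i j r = K * r) {r : ℝ} (hr : 0 ≤ r) (hKr : K * r < 1) :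
    L.u i j r < 1 := by
  classical
  by_contra! hur
  obtain ⟨q, hrq, hqK⟩ : ∃ q : ℚ, r < q ∧ (q : ℝ) < 1 / K :=
    exists_rat_btwn (by rw [lt_div_iff₀ hK]; linarith)
  have hq : (0 : ℝ) < q := hr.trans_lt hrq
  have hKq : K * q < 1 := by rw [lt_div_iff₀ hK] at hqK; linarith
  have huq : 1 ≤ L.u i j q := hur.trans (L.u_mono i j hr hq.le hrq.le)
  -- the first halving of `q` at which the modulus is below one
  obtain ⟨s, hs, hus, hu2s, hK2s⟩ : ∃ s : ℚ, (0 : ℝ) < s ∧ L.u i j s < 1 ∧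
      1 ≤ L.u i j (2 * s) ∧ K * (2 * s) < 1 := by
    have hex : ∃ k : ℕ, L.u i j (q / 2 ^ k) < 1 := by
      have ht : Filter.Tendsto (fun k : ℕ => (q : ℝ) / 2 ^ k) Filter.atTop
          (nhdsWithin 0 (Set.Ioi 0)) := by
        refine tendsto_nhdsWithin_iff.2 ⟨?_, .of_forall fun k => ?_⟩
        · have := (tendsto_pow_atTop_nhds_zero_of_lt_one (r := (1 / 2 : ℝ)) (by norm_num)
            (by norm_num)).const_mul (q : ℝ)
          simpa [div_eq_mul_inv] using this
        · simp only [Set.mem_Ioi]; positivity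
      exact (((L.u_lim i j).comp ht).eventually (gt_mem_nhds one_pos)).exists
    have hfind := Nat.find_spec hex
    have hpos : Nat.find hex ≠ 0 := fun h => by
      rw [h] at hfind
      norm_num at hfind
      linarith
    obtain ⟨k, hk⟩ := Nat.exists_eq_succ_of_ne_zero hpos
    have hmin := Nat.find_min hex (m := k) (by omega)
    rw [hk] at hfind
    have e : 2 * ((q : ℝ) / 2 ^ (k + 1)) = q / 2 ^ k := by field_simp; ring
    refine ⟨q / 2 ^ (k + 1), by push_cast; positivity, by exact_mod_cast hfind, ?_, ?_⟩
    · push_cast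
      rw [e]
      exact not_lt.1 hmin
    · push_cast
      rw [e]
      have : (q : ℝ) / 2 ^ k ≤ q := div_le_self hq.le (one_le_pow₀ (by norm_num))
      nlinarith
  obtain ⟨D, hsD, huD⟩ : ∃ D : ℚ, (2 * s : ℝ) ≤ D ∧ ∀ k, 1 ≤ L.u i k D := by
    choose B hB using fun k => hbdd i k
    obtain ⟨D, hD⟩ := exists_rat_gt (2 * (s : ℝ) + ∑ k, |B k|)
    have hsum : 0 ≤ ∑ k, |B k| := Finset.sum_nonneg fun k _ => abs_nonneg _
    refine ⟨D, by linarith, fun k => ?_⟩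
    by_contra! hlt
    have h1 : (D : ℝ) ≤ B k := hB k ⟨by linarith, hlt⟩
    have h2 := Finset.single_le_sum (f := fun k => |B k|) (fun k _ => abs_nonneg _)
      (Finset.mem_univ k)
    linarith [le_abs_self (B k)]
  have h2s : (0 : ℝ) < 2 * s := by linarith
  have hD : (0 : ℝ) < D := by linarith
  have hsΔ : (s : ℝ) ∈ Δ := by rw [hΔ]; exact ⟨hs, s, rfl⟩
  have h2sΔ : (2 * s : ℝ) ∈ Δ := by rw [hΔ]; exact ⟨h2s, 2 * s, by push_cast; rfl⟩
  have hDΔ : (D : ℝ) ∈ Δ := by rw [hΔ]; exact ⟨hD, D, rfl⟩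
  let w₀ : Fin (L.n i) → Fin 3 := fun k => if k = j then 1 else 2
  let RC : (i' : L.I) → (Fin (L.n i') → Fin 3) → ℝ := fun i' w =>
    if (⟨i', w⟩ : Σ i', Fin (L.n i') → Fin 3) = ⟨i, w₀⟩ then 1 else 0
  have hRC : ∀ (i' : L.I) w, (RC i' w = 1 ∧
      (⟨i', w⟩ : Σ i', Fin (L.n i') → Fin 3) = ⟨i, w₀⟩) ∨ RC i' w = 0 := fun i' w => by
    by_cases h : (⟨i', w⟩ : Σ i', Fin (L.n i') → Fin 3) = ⟨i, w₀⟩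
    · exact Or.inl ⟨if_pos h, h⟩
    · exact Or.inr (if_neg h)
  have hw₀ : ∀ (k : Fin (L.n i)) (x : Fin 3), w₀ k ≠ x →
      1 ≤ L.u i k (if w₀ k = 2 ∨ x = 2 then (D : ℝ) else 2 * s) := by
    intro k x _
    split_ifs with h
    · exact huD k
    · have hkj : k = j := by
        by_contra hkj
        exact h (Or.inl (if_neg hkj))
      rw [hkj]
      exact hu2s
  let C : PreStr L := isosceles h2s hD (by linarith) RC
    (fun i' w => by rcases hRC i' w with h | h <;> simp [h])
    (fun i' k x y hxy hk => by
      have hu := L.u_nonneg i' k (if x k = 2 ∨ y k = 2 then (D : ℝ) else 2 * s)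
      rcases hRC i' x with ⟨hx, ex⟩ | hx <;> rcases hRC i' y with ⟨hy, ey⟩ | hy
      · simpa [hx, hy] using hu
      · cases ex
        simpa [hx, hy] using hw₀ k (y k) hk
      · cases ey
        simpa [hx, hy, or_comm] using hw₀ k (x k) hk.symm
      · simpa [hx, hy] using hu)
  have hCv : Valued Δ V C := valued_isosceles h2sΔ hDΔ fun i' w => by
    rcases hRC i' w with h | h <;> simpa [h]
  let B : PreStr L := isosceles h2s hs le_rfl (fun _ _ => 0) (fun _ _ => by simp)
    (fun _ _ _ _ _ _ => by simp [L.u_nonneg])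
  have hBv : Valued Δ V B := valued_isosceles h2sΔ hsΔ fun _ _ => h0
  obtain ⟨t, -, -, ht, hT⟩ := IsPartialIso.exists_extend_finite hA hCv Set.finite_empty .empty
    (Set.finite_univ (α := Fin 3))
  choose f hf using fun p => hT p (Set.mem_univ p)
  have hfd : ∀ x y : Fin 3, A.d (f x) (f y) = C.d x y := fun x y => ht.1 _ (hf x) _ (hf y)
  have hfR : ∀ i' (w : Fin (L.n i') → Fin 3), A.R i' (fun k => f (w k)) = RC i' w := fun i' w =>
    ht.2 i' (fun k => (w k, f (w k))) fun k => hf (w k)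
  have hpi : IsPartialIso B A {((0 : Fin 3), f 0), ((1 : Fin 3), f 1)} := by
    have hcases : ∀ p ∈ ({((0 : Fin 3), f 0), ((1 : Fin 3), f 1)} : Set (Fin 3 × A.M)),
        p.1 ≠ 2 ∧ p.2 = f p.1 := by
      rintro p (rfl | rfl) <;> simp
    refine ⟨fun p hp q hq => ?_, fun i' w hw => ?_⟩
    · rw [(hcases p hp).2, (hcases q hq).2, hfd]
      have hp2 : p.1 ≠ 2 := (hcases p hp).1
      have hq2 : q.1 ≠ 2 := (hcases q hq).1
      simp only [C, B, hp2, hq2, or_self, if_false]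
    · rw [show (fun k => (w k).2) = fun k => f (w k).1 from funext fun k => (hcases _ (hw k)).2,
        hfR]
      rcases hRC i' fun k => (w k).1 with ⟨-, e⟩ | h
      · obtain ⟨rfl, e⟩ := Sigma.mk.inj e
        have e := congrFun (eq_of_heq e)
        obtain ⟨k, hk⟩ : ∃ k, k ≠ j := by
          have : Nontrivial (Fin (L.n i')) := Fin.nontrivial_iff_two_le.2 hn
          exact exists_ne j
        exact ((hcases _ (hw k)).1 ((e k).trans (if_neg hk))).elim
      · exact h
  obtain ⟨z, hz⟩ := hpi.exists_insert hA hBv (Set.toFinite _) (2 : Fin 3)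
  have hz0 : A.d z (f 0) = s := by
    have := hz.1 ((2 : Fin 3), z) (by simp) ((0 : Fin 3), f 0) (by simp)
    simpa [B] using this
  have hz1 : A.d z (f 1) = s := by
    have := hz.1 ((2 : Fin 3), z) (by simp) ((1 : Fin 3), f 1) (by simp)
    simpa [B] using this
  let v : A.M → Fin (L.n i) → A.M := fun a k => if k = j then a else f 2
  have hv : ∀ a a', |A.R i (v a) - A.R i (v a')| ≤ L.u i j (A.d a a') := fun a a' => by
    have := A.R_uc i j (v a) (v a') fun k hk => by simp [v, hk]
    simpa [v] using this
  have hv1 : A.R i (v (f 1)) = 1 := by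
    rw [show v (f 1) = fun k => f (w₀ k) from funext fun k => by
      by_cases hk : k = j <;> simp [v, w₀, hk], hfR]
    exact if_pos rfl
  have hv0 : A.R i (v (f 0)) = 0 := by
    rw [show v (f 0) = fun k => f (if k = j then 0 else 2) from funext fun k => by
      by_cases hk : k = j <;> simp [v, hk], hfR]
    rcases hRC i fun k => if k = j then 0 else 2 with ⟨-, e⟩ | h
    · have := congrFun (eq_of_heq (Sigma.mk.inj e).2) j
      simp [w₀] at this
    · exact h
  have e0 := hv z (f 0)
  have e1 := hv z (f 1)
  rw [hz0, hv0, hKu s ⟨hs.le, hus⟩, abs_le] at e0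
  rw [hz1, hv1, hKu s ⟨hs.le, hus⟩, abs_le] at e1
  linarith

/-- The functions `c j` agree with the moduli `u i j` below one, are superadditive there, and are
subadditive if the relation is not unary. -/
structure IsCost (L : Sig) (i : L.I) (c : Fin (L.n i) → ℝ → ℝ) : Prop where
  zero : ∀ j, c j 0 = 0
  nonneg : ∀ j t, 0 ≤ t → 0 ≤ c j t
  mono : ∀ j, MonotoneOn (c j) (Set.Ici 0)
  eq_of_lt : ∀ j t, 0 ≤ t → (L.u i j t < 1 ∨ c j t < 1) → L.u i j t = c j t
  superadd : ∀ j s t, 0 ≤ s → 0 ≤ t → c j (s + t) < 1 → c j s + c j t ≤ c j (s + t)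
  subadd : 2 ≤ L.n i → ∀ j s t, 0 ≤ s → 0 ≤ t → c j (s + t) ≤ c j s + c j t

theorem exists_isCost (hL : L.Semiproper)
    (hΔ : Δ = {x : ℝ | 0 < x ∧ ∃ q : ℚ, x = (q : ℝ)}) (h0 : (0 : ℝ) ∈ V) (h1 : (1 : ℝ) ∈ V)
    (hA : HasUrysohnRel Δ V A) (i : L.I) : ∃ c, IsCost L i c := by
  obtain ⟨hbdd, hsuper, hlin⟩ := hL
  by_cases hn : 2 ≤ L.n i
  · choose K hK hKu using hlin i hn
    refine ⟨fun j t => K j * t, fun j => by simp, fun j t ht => mul_nonneg (hK j).le ht,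
      fun j s _ t _ hst => mul_le_mul_of_nonneg_left hst (hK j).le, fun j t ht h => ?_,
      fun j s t _ _ _ => (mul_add _ _ _).ge, fun _ j s t _ _ => (mul_add _ _ _).le⟩
    rcases h with h | h
    · exact hKu j t ⟨ht, h⟩
    · exact hKu j t ⟨ht, lt_one_of_mul_lt_one_of_hasUrysohnRel hbdd hΔ h0 h1 hA hn j (hK j)
        (hKu j) ht h⟩
  · refine ⟨L.u i, L.u_zero i, fun j t _ => L.u_nonneg i j t, L.u_mono i, fun _ _ _ _ => rfl,
      fun j s t hs ht h => ?_, fun h => (hn h).elim⟩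
    have hst : (0 : ℝ) ≤ s + t := add_nonneg hs ht
    exact hsuper i j s t ⟨hs, (L.u_mono i j hs hst (by linarith)).trans_lt h⟩
      ⟨ht, (L.u_mono i j ht hst (by linarith)).trans_lt h⟩ ⟨hst, h⟩

namespace IsCost

variable {i : L.I} {c : Fin (L.n i) → ℝ → ℝ}

theorem le_of_le (hc : IsCost L i c) {j : Fin (L.n i)} {t v : ℝ} (ht : 0 ≤ t) (hv : v ≤ 1)
    (h : v ≤ L.u i j t) : v ≤ c j t := by
  by_cases hct : c j t < 1
  · rwa [← hc.eq_of_lt j t ht (.inr hct)]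
  · linarith

theorem le_modulus_of_le (hc : IsCost L i c) {j : Fin (L.n i)} {t v : ℝ} (ht : 0 ≤ t) (hv : v ≤ 1)
    (h : v ≤ c j t) : v ≤ L.u i j t := by
  by_cases hut : L.u i j t < 1
  · rwa [hc.eq_of_lt j t ht (.inl hut)]
  · linarith

theorem abs_R_sub_le (hc : IsCost L i c) (A : PreStr L) (x y : Fin (L.n i) → A.M) :
    |A.R i x - A.R i y| ≤ ∑ j, c j (A.d (x j) (y j)) :=
  abs_sub_le_sum_of_single_coordinate _ (fun j p q => c j (A.d p q))
    (fun j x y h => hc.le_of_le (A.d_nonneg_s14 _ _) (A.abs_R_sub_le_one i x y) (A.R_uc i j x y h)) x y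

theorem max_zero_sub_sum_mem (hc : IsCost L i c) (hgood : GoodPair L Δ V) {v : ℝ} (hv : v ∈ V)
    {t : Fin (L.n i) → ℝ} (ht : ∀ j, t j = 0 ∨ t j ∈ Δ) (F : Finset (Fin (L.n i))) :
    max 0 (v - ∑ j ∈ F, c j (t j)) ∈ V := by
  classical
  obtain ⟨hΔ, hV, -, h0, hsub⟩ := hgood
  induction F using Finset.induction_on with
  | empty => simpa [max_eq_right (hV hv).1] using hv
  | insert j F hj ih =>
    rw [Finset.sum_insert hj]
    have htj : 0 ≤ t j := (ht j).elim ge_of_eq fun h => (hΔ.1 h).le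
    have hcj := hc.nonneg j (t j) htj
    by_cases hle : v - (c j (t j) + ∑ j ∈ F, c j (t j)) ≤ 0
    · rwa [max_eq_left hle]
    rw [not_le] at hle
    rw [max_eq_right hle.le]
    rw [max_eq_right (by linarith)] at ih
    rcases ht j with h | h
    · rw [h, hc.zero, zero_add]
      exact ih
    · have h1 := (hV ih).2
      have hlt : c j (t j) < 1 := by linarith
      have hu := hc.eq_of_lt j _ htj (.inr hlt)
      have := hsub _ ih _ h i j (by rw [hu]; linarith)
      rw [hu] at this
      convert this using 1
      ring

end IsCost

/-- A metric on the disjoint union, gluing `q` to `f q` at distance `δ`. -/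
theorem exists_glue_metric (P Q : PreStr L) [Finite Q.M] [Nonempty Q.M] (f : Q.M → P.M) {δ : ℝ}
    (hδ : 0 < δ) (hd : ∀ x y, |P.d (f x) (f y) - Q.d x y| ≤ 2 * δ) :
    ∃ D : P.M ⊕ Q.M → P.M ⊕ Q.M → ℝ, (∀ x, D x x = 0) ∧ (∀ x y, D x y = 0 → x = y) ∧
      (∀ x y, D x y = D y x) ∧ (∀ x y z, D x z ≤ D x y + D y z) ∧
      (∀ x y, D (.inl x) (.inl y) = P.d x y) ∧ (∀ x y, D (.inr x) (.inr y) = Q.d x y) ∧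
      (∀ x y, ∃ z, D (.inl x) (.inr y) = P.d x (f z) + Q.d y z + δ) ∧
      ∀ y, D (.inl (f y)) (.inr y) = δ := by
  let := P.metricSpace
  let := Q.metricSpace
  let m : MetricSpace (P.M ⊕ Q.M) := Metric.glueMetricApprox f id δ hδ hd
  refine ⟨m.dist, dist_self, fun x y => eq_of_dist_eq_zero, dist_comm, dist_triangle,
    fun _ _ => rfl, fun _ _ => rfl, fun x y => ?_,
    fun y => Metric.glueDist_glued_points f id δ y⟩
  obtain ⟨z, hz⟩ := exists_eq_ciInf_of_finite (f := fun z => dist x (f z) + dist y (id z))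
  exact ⟨z, congrArg (· + δ) hz.symm⟩

/-- Two finite valued structures related by an approximate isomorphism embed in a common valued
structure in which corresponding points are at distance `δ`. -/
theorem exists_approximate_amalgam
    (hΔ : Δ = {x : ℝ | 0 < x ∧ ∃ q : ℚ, x = (q : ℝ)}) (hgood : GoodPair L Δ V)
    (hcost : ∀ i, ∃ c, IsCost L i c) (P Q : PreStr L) [Finite P.M] [Finite Q.M] [Nonempty Q.M]
    (hP : Valued Δ V P) (hQ : Valued Δ V Q) (f : Q.M → P.M) {δ : ℝ} (hδ : δ ∈ Δ)
    (hd : ∀ x y, |P.d (f x) (f y) - Q.d x y| ≤ 2 * δ)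
    (hR : ∀ i (w : Fin (L.n i) → Q.M), |P.R i (f ∘ w) - Q.R i w| ≤ ∑ j, L.u i j δ) :
    ∃ (N : PreStr L) (a : P.M → N.M) (b : Q.M → N.M), Finite N.M ∧ Valued Δ V N ∧
      Emb P N a ∧ Emb Q N b ∧ ∀ y, N.d (a (f y)) (b y) = δ := by
  have hδ0 : 0 < δ := hgood.1.1 hδ
  obtain ⟨D, hself, hzero, hcomm, htri, hll, hrr, hlr, hglue⟩ := exists_glue_metric P Q f hδ0 hd
  have hDnn : ∀ x y, 0 ≤ D x y := fun x y => by
    have := htri x y x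
    rw [hself, hcomm y x] at this
    linarith
  have hlrΔ : ∀ x y, D (.inl x) (.inr y) ∈ Δ := fun x y => by
    obtain ⟨z, hz⟩ := hlr x y
    have hrat : ∀ (S : PreStr L) (_ : Valued Δ V S) (p q : S.M), ∃ r : ℚ, S.d p q = r :=
      fun S hS p q => by
        by_cases hpq : p = q
        · exact ⟨0, by rw [hpq, S.d_self, Rat.cast_zero]⟩
        · exact (hΔ ▸ hS.1 p q hpq).2
    obtain ⟨r₁, h₁⟩ := hrat P hP x (f z)
    obtain ⟨r₂, h₂⟩ := hrat Q hQ y z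
    obtain ⟨-, r₃, h₃⟩ := hΔ ▸ hδ
    have hx := P.d_nonneg_s14 x (f z)
    have hy := Q.d_nonneg_s14 y z
    rw [hz, hΔ]
    exact ⟨by linarith, r₁ + r₂ + r₃, by rw [h₁, h₂, h₃]; push_cast; rfl⟩
  have hDΔ : ∀ x y, x ≠ y → D x y ∈ Δ := by
    rintro (x | x) (y | y) hxy
    · rw [hll]; exact hP.1 _ _ fun h => hxy (h ▸ rfl)
    · exact hlrΔ x y
    · rw [hcomm]; exact hlrΔ y x
    · rw [hrr]; exact hQ.1 _ _ fun h => hxy (h ▸ rfl)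
  choose c hc using hcost
  let T : L.I → Type := fun i => (Fin (L.n i) → P.M) ⊕ (Fin (L.n i) → Q.M)
  let val : ∀ i, T i → ℝ := fun i => Sum.elim (P.R i) (Q.R i)
  let emb : ∀ i, T i → Fin (L.n i) → P.M ⊕ Q.M :=
    fun i => Sum.elim (fun w => Sum.inl ∘ w) fun w => Sum.inr ∘ w
  let cost : ∀ i, (Fin (L.n i) → P.M ⊕ Q.M) → (Fin (L.n i) → P.M ⊕ Q.M) → ℝ :=
    fun i x y => ∑ j, c i j (D (x j) (y j))
  have hval : ∀ i k, val i k ∈ V := by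
    rintro i (w | w)
    exacts [hP.2 i w, hQ.2 i w]
  have hval01 : ∀ i k, val i k ∈ Set.Icc (0 : ℝ) 1 := fun i k => hgood.2.1 (hval i k)
  have hcomm' : ∀ i x y, cost i x y = cost i y x := fun i x y => by
    simp only [cost, hcomm]
  have hself' : ∀ i x, cost i x x = 0 := fun i x => by simp [cost, hself, (hc i).zero]
  have hmixed : ∀ i p q, |P.R i p - Q.R i q| ≤ cost i (Sum.inl ∘ p) (Sum.inr ∘ q) := by
    intro i p q
    by_cases hbig : ∃ j, 1 ≤ c i j (D (.inl (p j)) (.inr (q j)))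
    · obtain ⟨j, hj⟩ := hbig
      have h1 := Finset.single_le_sum
        (f := fun j => c i j (D ((Sum.inl ∘ p) j) ((Sum.inr ∘ q) j)))
        (fun j _ => (hc i).nonneg j _ (hDnn _ _)) (Finset.mem_univ j)
      have h2 := P.R_mem i p
      have h3 := Q.R_mem i q
      have h4 : |P.R i p - Q.R i q| ≤ 1 := by
        rw [abs_le]
        constructor <;> linarith [h2.1, h2.2, h3.1, h3.2]
      exact h4.trans (hj.trans h1)
    push Not at hbig
    choose s hs using fun j => hlr (p j) (q j)
    have hterm : ∀ j, c i j (P.d (p j) (f (s j))) + c i j (Q.d (q j) (s j)) + L.u i j δ ≤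
        c i j (D (.inl (p j)) (.inr (q j))) := fun j => by
      have hb := hbig j
      have hx := P.d_nonneg_s14 (p j) (f (s j))
      have hy := Q.d_nonneg_s14 (q j) (s j)
      rw [hs] at hb ⊢
      have hb2 : c i j δ < 1 :=
        ((hc i).mono j hδ0.le (add_nonneg (add_nonneg hx hy) hδ0.le) (by linarith)).trans_lt hb
      have hb3 : c i j (P.d (p j) (f (s j)) + Q.d (q j) (s j)) < 1 :=
        ((hc i).mono j (add_nonneg hx hy) (add_nonneg (add_nonneg hx hy) hδ0.le)
          (by linarith)).trans_lt hb
      have e1 := (hc i).superadd j _ _ (add_nonneg hx hy) hδ0.le hb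
      have e2 := (hc i).superadd j _ _ hx hy hb3
      rw [(hc i).eq_of_lt j δ hδ0.le (.inr hb2)]
      linarith
    have hsum := Finset.sum_le_sum fun j (_ : j ∈ Finset.univ) => hterm j
    rw [Finset.sum_add_distrib, Finset.sum_add_distrib] at hsum
    refine le_trans ?_ hsum
    have e1 := (hc i).abs_R_sub_le P p (f ∘ s)
    have e2 := (hc i).abs_R_sub_le Q q s
    have e3 := hR i s
    simp only [Function.comp_apply] at e1
    rw [abs_le] at *
    constructor <;> linarith
  have hknown : ∀ i k l, |val i k - val i l| ≤ cost i (emb i k) (emb i l) := by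
    rintro i (p | p) (q | q)
    · simpa [cost, emb, val, hll] using (hc i).abs_R_sub_le P p q
    · exact hmixed i p q
    · rw [abs_sub_comm, hcomm']
      exact hmixed i q p
    · simpa [cost, emb, val, hrr] using (hc i).abs_R_sub_le Q p q
  have hTne : ∀ i, Nonempty (T i) := fun i => ⟨.inr fun _ => Classical.arbitrary _⟩
  let R : ∀ i, (Fin (L.n i) → P.M ⊕ Q.M) → ℝ :=
    fun i x => ⨆ k, max 0 (val i k - cost i x (emb i k))
  have hRle : ∀ i x k, max 0 (val i k - cost i x (emb i k)) ≤ R i x := fun i x k =>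
    le_ciSup (f := fun k => max 0 (val i k - cost i x (emb i k))) (Set.finite_range _).bddAbove k
  have hRex : ∀ i x, ∃ k, max 0 (val i k - cost i x (emb i k)) = R i x := fun i x =>
    exists_eq_ciSup_of_finite (f := fun k => max 0 (val i k - cost i x (emb i k)))
  have hRemb : ∀ i k, R i (emb i k) = val i k := fun i k => by
    refine le_antisymm ?_ ?_
    · obtain ⟨l, hl⟩ := hRex i (emb i k)
      rw [← hl]
      have := (abs_le.1 (hknown i k l)).1
      exact max_le (hval01 i k).1 (by linarith)
    · have := (le_max_right _ _).trans (hRle i (emb i k) k)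
      rwa [hself', sub_zero] at this
  have hRV : ∀ i x, R i x ∈ V := fun i x => by
    obtain ⟨k, hk⟩ := hRex i x
    rw [← hk]
    refine (hc i).max_zero_sub_sum_mem hgood (hval i k) (fun j => ?_) Finset.univ
    by_cases hj : x j = emb i k j
    · exact .inl (by rw [hj, hself])
    · exact .inr (hDΔ _ _ hj)
  have hRcost : ∀ i x y, |R i x - R i y| ≤ cost i x y := by
    intro i x y
    by_cases hn : 2 ≤ L.n i
    · have hone : ∀ x y, R i x - R i y ≤ cost i x y := fun x y => by
        obtain ⟨k, hk⟩ := hRex i x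
        have h2 := hRle i y k
        have h3 : cost i y (emb i k) ≤ cost i x y + cost i x (emb i k) := by
          simp only [cost, ← Finset.sum_add_distrib]
          refine Finset.sum_le_sum fun j _ => ?_
          have h4 := htri (y j) (x j) (emb i k j)
          rw [hcomm (y j) (x j)] at h4
          exact ((hc i).mono j (hDnn _ _) (add_nonneg (hDnn _ _) (hDnn _ _)) h4).trans
            ((hc i).subadd hn j _ _ (hDnn _ _) (hDnn _ _))
        have h5 : 0 ≤ cost i x y := Finset.sum_nonneg fun j _ => (hc i).nonneg j _ (hDnn _ _)
        have h6 := le_max_left 0 (val i k - cost i y (emb i k))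
        have h7 := le_max_right 0 (val i k - cost i y (emb i k))
        rw [← hk, sub_le_iff_le_add]
        exact max_le (by linarith) (by linarith)
      rw [abs_sub_le_iff]
      exact ⟨hone x y, (hone y x).trans_eq (hcomm' i y x)⟩
    · have hn1 : L.n i = 1 := le_antisymm (by omega) (L.n_pos i)
      have : Subsingleton (Fin (L.n i)) := by rw [hn1]; infer_instance
      have hsurj : ∀ x, ∃ k, emb i k = x := fun x => by
        let j : Fin (L.n i) := ⟨0, L.n_pos i⟩
        rcases hx : x j with p | q
        · exact ⟨.inl fun _ => p, funext fun k => by rw [Subsingleton.elim k j, hx]; rfl⟩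
        · exact ⟨.inr fun _ => q, funext fun k => by rw [Subsingleton.elim k j, hx]; rfl⟩
      obtain ⟨k, rfl⟩ := hsurj x
      obtain ⟨l, rfl⟩ := hsurj y
      rw [hRemb, hRemb]
      exact hknown i k l
  have hR01 : ∀ i x, R i x ∈ Set.Icc (0 : ℝ) 1 := fun i x => hgood.2.1 (hRV i x)
  let N : PreStr L :=
    { M := P.M ⊕ Q.M
      d := D
      d_self := hself
      d_eq_zero := hzero
      d_comm := hcomm
      d_triangle := htri
      R := R
      R_mem := hR01
      R_uc := fun i j x y h => by
        refine (hc i).le_modulus_of_le (hDnn _ _) ?_ ?_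
        · have h1 := hR01 i x
          have h2 := hR01 i y
          rw [abs_le]
          constructor <;> linarith [h1.1, h1.2, h2.1, h2.2]
        · refine (hRcost i x y).trans_eq (Finset.sum_eq_single j (fun k _ hk => ?_) (by simp))
          rw [h k hk, hself, (hc i).zero] }
  exact ⟨N, .inl, .inr, inferInstanceAs (Finite (P.M ⊕ Q.M)), ⟨hDΔ, hRV⟩,
    ⟨Sum.inl_injective, hll, fun i x => hRemb i (.inl x)⟩,
    ⟨Sum.inr_injective, hrr, fun i x => hRemb i (.inr x)⟩, hglue⟩

/-- An approximate isomorphism between finite subsets of `A` is uniformly close to the restriction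
of an automorphism of `A`. -/
theorem exists_equiv_near [Countable A.M]
    (hΔ : Δ = {x : ℝ | 0 < x ∧ ∃ q : ℚ, x = (q : ℝ)}) (hgood : GoodPair L Δ V)
    (hcost : ∀ i, ∃ c, IsCost L i c) (hAv : Valued Δ V A) (hA : HasUrysohnRel Δ V A)
    {T : Set A.M} (hT : T.Finite) (hTne : T.Nonempty) (f : A.M → A.M) {δ : ℝ} (hδ : δ ∈ Δ)
    (hd : ∀ x y, |A.d (f x) (f y) - A.d x y| ≤ 2 * δ)
    (hR : ∀ i (w : Fin (L.n i) → A.M), |A.R i (f ∘ w) - A.R i w| ≤ ∑ j, L.u i j δ) :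
    ∃ σ : A.M ≃ A.M, (∀ x y, A.d (σ x) (σ y) = A.d x y) ∧
      (∀ i (w : Fin (L.n i) → A.M), A.R i (σ ∘ w) = A.R i w) ∧
      ∀ y ∈ T, A.d (f y) (σ y) = δ := by
  have : Finite T := hT.to_subtype
  have : Nonempty T := hTne.to_subtype
  have : Finite (f '' T) := (hT.image f).to_subtype
  obtain ⟨N, α, β, hNfin, hNv, hα, hβ, hαβ⟩ := exists_approximate_amalgam hΔ hgood hcost
    (A.restrict (f '' T)) (A.restrict T) (hAv.restrict _) (hAv.restrict _)
    (fun y => ⟨f y.1, Set.mem_image_of_mem f y.2⟩) hδ (fun x y => hd x.1 y.1)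
    (fun i w => hR i fun k => (w k).1)
  have hs : IsPartialIso N A (Set.range fun p : f '' T => (α p, p.1)) := by
    constructor
    · rintro _ ⟨p, rfl⟩ _ ⟨q, rfl⟩
      exact (hα.2.1 p q).symm
    · intro i w hw
      choose p hp using hw
      obtain rfl : (fun k => (α (p k), (p k).1)) = w := funext hp
      exact (hα.2.2 i p).symm
  obtain ⟨t, hst, -, ht, htot⟩ :=
    hs.exists_extend_finite hA hNv (Set.finite_range _) Set.finite_univ
  choose b hb using fun y => htot (β y) (Set.mem_univ _)
  have hpi : IsPartialIso A A (Set.range fun y : T => (y.1, b y)) := by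
    constructor
    · rintro _ ⟨x, rfl⟩ _ ⟨y, rfl⟩
      exact (ht.1 _ (hb x) _ (hb y)).trans (hβ.2.1 x y)
    · intro i w hw
      choose y hy using hw
      obtain rfl : (fun k => ((y k).1, b (y k))) = w := funext hy
      exact (ht.2 i (fun k => (β (y k), b (y k))) fun k => hb _).trans (hβ.2.2 i y)
  obtain ⟨σ, hσd, hσR, hσ⟩ := hpi.exists_equiv hA hAv (Set.finite_range _)
  refine ⟨σ, hσd, hσR, fun y hy => ?_⟩
  rw [hσ _ ⟨⟨y, hy⟩, rfl⟩]
  exact (ht.1 _ (hst ⟨⟨f y, Set.mem_image_of_mem f hy⟩, rfl⟩) _ (hb ⟨y, hy⟩)).trans (hαβ ⟨y, hy⟩)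

end Auxiliary

/-- Theorem (paper Thm 5.8): let `L` be proper, `Δ = ℚ ∩ (0, ∞)`, and
`V ⊇ ℚ ∩ [0,1]` with `(Δ, V)` a good value pair for `L`.  Let `A` be a
countable `(Δ, V)`-valued continuous `L`-pre-structure with the rational
Urysohn property and let `Abar` be a continuous `L`-structure containing `A` as
a dense substructure.  Then the automorphisms of `Abar` mapping `A` onto itself
are dense in `Aut(Abar)` for the topology of pointwise convergence. -/
theorem stmt14 (L : Sig) (hL : L.Proper) (Δ V : Set ℝ)
    (hΔ : Δ = {x : ℝ | 0 < x ∧ ∃ q : ℚ, x = (q : ℝ)})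
    (hV : ∀ q : ℚ, 0 ≤ (q : ℝ) → (q : ℝ) ≤ 1 → (q : ℝ) ∈ V)
    (hgood : GoodPair L Δ V)
    (A : PreStr L) (hAcnt : Countable A.M) (hAval : Valued Δ V A)
    (hA : HasUrysohnRel Δ V A)
    (Abar : PreStr L) (ι : A.M → Abar.M) (hι : Emb A Abar ι)
    (hdense : ∀ x : Abar.M, ∀ ε : ℝ, 0 < ε → ∃ y : A.M, Abar.d x (ι y) < ε)
    (hcomp : Abar.IsComplete) :
    ∀ g : Abar.M → Abar.M, Aut Abar g →
      ∀ (m : ℕ) (xs : Fin m → Abar.M), ∀ ε : ℝ, 0 < ε →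
        ∃ h : Abar.M → Abar.M, Aut Abar h ∧ h '' Set.range ι = Set.range ι ∧
          ∀ k : Fin m, Abar.d (g (xs k)) (h (xs k)) < ε := by
  intro g hg m xs ε hε
  rcases Nat.eq_zero_or_pos m with rfl | hm
  · exact ⟨id, ⟨Function.bijective_id, Function.injective_id, fun _ _ => rfl, fun _ _ => rfl⟩,
      by simp, fun k => k.elim0⟩
  obtain ⟨δ, hδ0, hδε⟩ : ∃ δ : ℚ, (0 : ℝ) < δ ∧ (δ : ℝ) < ε / 4 :=
    exists_rat_btwn (by positivity)
  have hδ : (δ : ℝ) ∈ Δ := by rw [hΔ]; exact ⟨hδ0, δ, rfl⟩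
  have hcost := exists_isCost hL.1 hΔ (by simpa using hV 0) (by simpa using hV 1) hA
  choose a ha using fun k => hdense (xs k) (ε / 4) (by positivity)
  choose f hf using fun y => hdense (g (ι y)) δ hδ0
  obtain ⟨σ, hσd, hσR, hσ⟩ := exists_equiv_near hΔ hgood hcost hAval hA
    (Set.finite_range a) ⟨a ⟨0, hm⟩, ⟨0, hm⟩, rfl⟩ f hδ
    (fun x y => by
      have := Abar.abs_d_sub_d_le (ι (f x)) (ι (f y)) (g (ι x)) (g (ι y))
      rw [hι.2.1, hg.2.2.1, hι.2.1, Abar.d_comm (ι (f x)), Abar.d_comm (ι (f y))] at this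
      linarith [hf x, hf y])
    (fun i w => by
      have := abs_sub_le_sum_of_single_coordinate _ (fun j p q => L.u i j (Abar.d p q))
        (Abar.R_uc i) (ι ∘ (f ∘ w)) (g ∘ (ι ∘ w))
      rw [hι.2.2, hg.2.2.2, hι.2.2] at this
      refine this.trans (Finset.sum_le_sum fun j _ =>
        L.u_mono i j (Abar.d_nonneg_s14 _ _) hδ0.le ?_)
      rw [Abar.d_comm]
      exact (hf (w j)).le)
  obtain ⟨h, hh, hhι⟩ := exists_aut_extension hι hcomp hdense σ hσd hσR
  refine ⟨h, hh, ?_, fun k => ?_⟩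
  · rw [← Set.range_comp, show h ∘ ι = ι ∘ σ from funext hhι, σ.surjective.range_comp]
  · have h1 : Abar.d (g (xs k)) (g (ι (a k))) < ε / 4 := by rw [hg.2.2.1]; exact ha k
    have h2 := hf (a k)
    have h3 : Abar.d (ι (f (a k))) (h (ι (a k))) = δ := by
      rw [hhι, hι.2.1]
      exact hσ _ ⟨k, rfl⟩
    have h4 : Abar.d (h (ι (a k))) (h (xs k)) < ε / 4 := by
      rw [hh.2.2.1, Abar.d_comm]; exact ha k
    have t1 := Abar.d_triangle (g (xs k)) (g (ι (a k))) (h (xs k))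
    have t2 := Abar.d_triangle (g (ι (a k))) (ι (f (a k))) (h (xs k))
    have t3 := Abar.d_triangle (ι (f (a k))) (h (ι (a k))) (h (xs k))
    linarith

end ContLogic
end
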